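/- (Different trajectories do not intersect.) Assume hypotheses (H1)–(H3), let q0, q be chosen with 1 − 1/p < 1/q0 < min{β, δα, δ/p, 1/2} and 1/(q0·δ) ≤ 1/q < min{α, 1/p}, and let ω : [0,T] → ℝ^m be continuous of finite p-variation. Let x and x̂ be two continuous paths of finite q-variation on [0,T] which are solutions of the Young differential equation x_t = x_0 + ∫_0^t f(s,x_s) ds + ∫_0^t g(s,x_s) dω_s (with possibly different initial values x_0, x̂_0). If x_a = x̂_a for some a ∈ [0,T], then x_t = x̂_t for all t ∈ [0,T]. -/

import Mathlib

open scoped BigOperators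
open Set

noncomputable section

/-- Euclidean space `ℝ^n`. -/
abbrev Ed (n : ℕ) : Type := EuclideanSpace ℝ (Fin n)

section PVarDefs

variable {E F : Type*} [NormedAddCommGroup E] [NormedSpace ℝ E]
  [NormedAddCommGroup F] [NormedSpace ℝ F]

/-- The set of sums `Σ_i ‖x (t (i+1)) - x (t i)‖ ^ p` over all finite partitions
`a = t 0 < t 1 < ⋯ < t n = b` of `[a,b]`. -/
def pVarSums (p : ℝ) (x : ℝ → E) (a b : ℝ) : Set ℝ :=
  { v | ∃ n : ℕ, ∃ t : Fin (n + 1) → ℝ, StrictMono t ∧ t 0 = a ∧ t (Fin.last n) = b ∧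
      v = ∑ i : Fin n, ‖x (t i.succ) - x (t i.castSucc)‖ ^ p }

/-- The `p`-variation seminorm `|||x|||_{p-var,[a,b]}`. -/
def pVar (p : ℝ) (x : ℝ → E) (a b : ℝ) : ℝ :=
  sSup (pVarSums p x a b) ^ (1 / p)

/-- `x` is of finite `p`-variation on `[a,b]`. -/
def FinitePVar (p : ℝ) (x : ℝ → E) (a b : ℝ) : Prop :=
  BddAbove (pVarSums p x a b)

/-- The `p`-variation norm `‖x‖_{p-var,[a,b]} = ‖x a‖ + |||x|||_{p-var,[a,b]}`. -/
def pVarNorm (p : ℝ) (x : ℝ → E) (a b : ℝ) : ℝ :=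
  ‖x a‖ + pVar p x a b

/-- A control function on `[a,b]`: continuous on the simplex, vanishing on the diagonal,
superadditive and nonnegative. -/
def IsControlOn (a b : ℝ) (w : ℝ → ℝ → ℝ) : Prop :=
  ContinuousOn (fun pr : ℝ × ℝ => w pr.1 pr.2) {pr : ℝ × ℝ | a ≤ pr.1 ∧ pr.1 ≤ pr.2 ∧ pr.2 ≤ b} ∧
  (∀ t : ℝ, a ≤ t → t ≤ b → w t t = 0) ∧
  (∀ s t u : ℝ, a ≤ s → s ≤ t → t ≤ u → u ≤ b → w s t + w t u ≤ w s u) ∧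
  (∀ s t : ℝ, a ≤ s → s ≤ t → t ≤ b → 0 ≤ w s t)

/-- A tagged partition `a = t 0 < t 1 < ⋯ < t n = b` of `[a,b]`, with tags
`tag i ∈ [t i, t (i+1)]`. -/
structure TaggedPartition (a b : ℝ) where
  n : ℕ
  t : Fin (n + 1) → ℝ
  tag : Fin n → ℝ
  mono : StrictMono t
  first : t 0 = a
  last : t (Fin.last n) = b
  tag_mem : ∀ i : Fin n, tag i ∈ Set.Icc (t i.castSucc) (t i.succ)

/-- The mesh of a tagged partition. -/
def TaggedPartition.mesh {a b : ℝ} (P : TaggedPartition a b) : ℝ :=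
  ⨆ i : Fin P.n, (P.t i.succ - P.t i.castSucc)

/-- Riemann–Stieltjes sum of `x` against `ω` along a tagged partition. -/
def RSSum (x : ℝ → E →L[ℝ] F) (ω : ℝ → E) {a b : ℝ} (P : TaggedPartition a b) : F :=
  ∑ i : Fin P.n, x (P.tag i) (ω (P.t i.succ) - ω (P.t i.castSucc))

/-- `v` is the Young integral `∫_a^b x dω`: the Riemann–Stieltjes sums converge to `v`
as the mesh tends to `0`. -/
def IsYoungIntegral (x : ℝ → E →L[ℝ] F) (ω : ℝ → E) (a b : ℝ) (v : F) : Prop :=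
  ∀ ε : ℝ, 0 < ε → ∃ δ : ℝ, 0 < δ ∧
    ∀ P : TaggedPartition a b, P.mesh < δ → ‖RSSum x ω P - v‖ < ε

/-- The Young integral `∫_a^b x dω` (an arbitrary value, `0`, if the limit does not exist). -/
def youngIntegral (x : ℝ → E →L[ℝ] F) (ω : ℝ → E) (a b : ℝ) : F :=
  letI := Classical.propDecidable (∃ v, IsYoungIntegral x ω a b v)
  if hv : ∃ v, IsYoungIntegral x ω a b v then hv.choose else 0

end PVarDefs

/-- `x` is a solution on `[t0,T1]` of the Young differential equation
`x t = x0 + ∫_{t0}^t f(s, x s) ds + ∫_{t0}^t g(s, x s) dω_s`, in the space of continuous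
paths of finite `q`-variation. -/
def IsSolutionOn {d m : ℕ} (f : ℝ → Ed d → Ed d) (g : ℝ → Ed d → (Ed m →L[ℝ] Ed d))
    (ω : ℝ → Ed m) (q t0 T1 : ℝ) (x0 : Ed d) (x : ℝ → Ed d) : Prop :=
  ContinuousOn x (Set.Icc t0 T1) ∧ FinitePVar q x t0 T1 ∧ x t0 = x0 ∧
    ∀ t ∈ Set.Icc t0 T1,
      x t = x0 + (∫ s in t0..t, f s (x s)) + youngIntegral (fun s => g s (x s)) ω t0 t



/-- A nonnegative superadditive function on the simplex over `[a,b]` which is uniformly small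
on short intervals. -/
structure IsUniformControl (a b : ℝ) (ρ : ℝ → ℝ → ℝ) : Prop where
  nonneg : ∀ s t, a ≤ s → s ≤ t → t ≤ b → 0 ≤ ρ s t
  superadd : ∀ s u t, a ≤ s → s ≤ u → u ≤ t → t ≤ b → ρ s u + ρ u t ≤ ρ s t
  small : ∀ ε, 0 < ε → ∃ η, 0 < η ∧ ∀ s t, a ≤ s → s ≤ t → t ≤ b → t - s < η → ρ s t ≤ ε

namespace IsUniformControl

variable {a b : ℝ} {ρ : ℝ → ℝ → ℝ}

theorem mono (hρ : IsUniformControl a b ρ) {s s' t' t : ℝ} (h1 : a ≤ s) (h2 : s ≤ s')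
    (h3 : s' ≤ t') (h4 : t' ≤ t) (h5 : t ≤ b) : ρ s' t' ≤ ρ s t := by
  have e1 := hρ.superadd s s' t h1 h2 (h3.trans h4) h5
  have e2 := hρ.superadd s' t' t (h1.trans h2) h3 h4 h5
  have e3 := hρ.nonneg s s' h1 h2 (by linarith)
  have e4 := hρ.nonneg t' t (by linarith) h4 h5
  linarith

theorem self (hρ : IsUniformControl a b ρ) {s : ℝ} (h1 : a ≤ s) (h2 : s ≤ b) : ρ s s = 0 := by
  have e1 := hρ.superadd s s s h1 le_rfl le_rfl h2
  have e2 := hρ.nonneg s s h1 le_rfl h2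
  linarith

theorem restrict (hρ : IsUniformControl a b ρ) {c e : ℝ} (hc : a ≤ c) (he : e ≤ b) :
    IsUniformControl c e ρ where
  nonneg s t h1 h2 h3 := hρ.nonneg s t (hc.trans h1) h2 (h3.trans he)
  superadd s u t h1 h2 h3 h4 := hρ.superadd s u t (hc.trans h1) h2 h3 (h4.trans he)
  small ε hε := by
    obtain ⟨η, hη, H⟩ := hρ.small ε hε
    exact ⟨η, hη, fun s t h1 h2 h3 h4 => H s t (hc.trans h1) h2 (h3.trans he) h4⟩

theorem add (hρ : IsUniformControl a b ρ) {σ : ℝ → ℝ → ℝ} (hσ : IsUniformControl a b σ) :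
    IsUniformControl a b (fun s t => ρ s t + σ s t) where
  nonneg s t h1 h2 h3 := add_nonneg (hρ.nonneg s t h1 h2 h3) (hσ.nonneg s t h1 h2 h3)
  superadd s u t h1 h2 h3 h4 := by
    have e1 := hρ.superadd s u t h1 h2 h3 h4
    have e2 := hσ.superadd s u t h1 h2 h3 h4
    linarith
  small ε hε := by
    obtain ⟨η, hη, H⟩ := hρ.small (ε / 2) (by linarith)
    obtain ⟨η', hη', H'⟩ := hσ.small (ε / 2) (by linarith)
    refine ⟨min η η', lt_min hη hη', fun s t h1 h2 h3 h4 => ?_⟩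
    have e1 := H s t h1 h2 h3 (h4.trans_le (min_le_left _ _))
    have e2 := H' s t h1 h2 h3 (h4.trans_le (min_le_right _ _))
    linarith

theorem length (a b : ℝ) : IsUniformControl a b (fun s t => t - s) where
  nonneg s t _ h2 _ := sub_nonneg.2 h2
  superadd s u t _ _ _ _ := by linarith
  small ε hε := ⟨ε, hε, fun s t _ _ _ h4 => h4.le⟩

theorem of_isControlOn (h : IsControlOn a b ρ) : IsUniformControl a b ρ where
  nonneg := h.2.2.2
  superadd s u t h1 h2 h3 h4 := h.2.2.1 s u t h1 h2 h3 h4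
  small ε hε := by
    obtain ⟨hc, h0, -, -⟩ := h
    set S : Set (ℝ × ℝ) := {pr : ℝ × ℝ | a ≤ pr.1 ∧ pr.1 ≤ pr.2 ∧ pr.2 ≤ b}
    have hS : IsCompact S := by
      have hcl : IsClosed S := by
        refine (isClosed_le continuous_const continuous_fst).inter
          ((isClosed_le continuous_fst continuous_snd).inter
            (isClosed_le continuous_snd continuous_const))
      refine (isCompact_Icc (a := a) (b := b)).prod (isCompact_Icc (a := a) (b := b))
        |>.of_isClosed_subset hcl ?_
      rintro ⟨x, y⟩ ⟨h1, h2, h3⟩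
      exact ⟨⟨h1, h2.trans h3⟩, ⟨h1.trans h2, h3⟩⟩
    have hu := hS.uniformContinuousOn_of_continuous hc
    rw [Metric.uniformContinuousOn_iff] at hu
    obtain ⟨η, hη, H⟩ := hu ε hε
    refine ⟨η, hη, fun s t h1 h2 h3 h4 => ?_⟩
    have := H (s, t) ⟨h1, h2, h3⟩ (s, s) ⟨h1, le_rfl, h2.trans h3⟩ (by
      rw [Prod.dist_eq]
      simpa [Real.dist_eq, abs_of_nonneg (sub_nonneg.2 h2), hη] using h4)
    simp only [h0 s h1 (h2.trans h3), Real.dist_eq, sub_zero] at this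
    exact (le_abs_self _).trans this.le

theorem sum_le (hρ : IsUniformControl a b ρ) {t : ℕ → ℝ} (ht : Monotone t)
    (hab : ∀ k, t k ∈ Icc a b) (n : ℕ) :
    ∑ k ∈ Finset.range n, ρ (t k) (t (k + 1)) ≤ ρ (t 0) (t n) := by
  induction n with
  | zero => simp [hρ.self (hab 0).1 (hab 0).2]
  | succ n ih =>
    rw [Finset.sum_range_succ]
    have := hρ.superadd (t 0) (t n) (t (n + 1)) (hab 0).1 (ht (Nat.zero_le _))
      (ht (Nat.le_succ _)) (hab _).2
    linarith

theorem sum_rpow_le (hρ : IsUniformControl a b ρ) {t : ℕ → ℝ} (ht : Monotone t)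
    (hab : ∀ k, t k ∈ Icc a b) {γ ε : ℝ} (hγ : 1 < γ)
    (hε : ∀ k, ρ (t k) (t (k + 1)) ≤ ε) (n : ℕ) :
    ∑ k ∈ Finset.range n, ρ (t k) (t (k + 1)) ^ γ ≤ ε ^ (γ - 1) * ρ (t 0) (t n) := by
  have h0 : ∀ k, 0 ≤ ρ (t k) (t (k + 1)) := fun k =>
    hρ.nonneg _ _ (hab _).1 (ht (Nat.le_succ _)) (hab _).2
  have hε0 : 0 ≤ ε := (h0 0).trans (hε 0)
  calc ∑ k ∈ Finset.range n, ρ (t k) (t (k + 1)) ^ γ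
      ≤ ∑ k ∈ Finset.range n, ε ^ (γ - 1) * ρ (t k) (t (k + 1)) := by
        refine Finset.sum_le_sum fun k _ => ?_
        have : ρ (t k) (t (k + 1)) ^ γ = ρ (t k) (t (k + 1)) ^ (γ - 1) * ρ (t k) (t (k + 1)) := by
          rw [← Real.rpow_add_one' (h0 k) (by linarith)]
          ring_nf
        rw [this]
        exact mul_le_mul_of_nonneg_right
          (Real.rpow_le_rpow (h0 k) (hε k) (by linarith)) (h0 k)
    _ = ε ^ (γ - 1) * ∑ k ∈ Finset.range n, ρ (t k) (t (k + 1)) := by rw [Finset.mul_sum]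
    _ ≤ _ := mul_le_mul_of_nonneg_left (hρ.sum_le ht hab n) (Real.rpow_nonneg hε0 _)

end IsUniformControl

/-- The points of the uniform grid of mesh `(b - a) / (n + 1)` on `[a,b]`, clamped to `[s,t]`. -/
def clampedGrid (a b s t : ℝ) (n k : ℕ) : ℝ :=
  max s (min t (a + k * ((b - a) / (n + 1))))

section Grid

variable {a b s t : ℝ}

theorem clampedGrid_zero (has : a ≤ s) (hst : s ≤ t) (n : ℕ) : clampedGrid a b s t n 0 = s := by
  simp [clampedGrid, has, has.trans hst]

theorem clampedGrid_last (hst : s ≤ t) (htb : t ≤ b) (n : ℕ) :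
    clampedGrid a b s t n (n + 1) = t := by
  have : a + ((n + 1 : ℕ) : ℝ) * ((b - a) / (n + 1)) = b := by
    push_cast
    field_simp
    ring
  rw [clampedGrid, this, min_eq_left htb, max_eq_right hst]

theorem clampedGrid_mono (hab : a ≤ b) (n : ℕ) : Monotone (clampedGrid a b s t n) := by
  intro i j hij
  have h0 : 0 ≤ (b - a) / ((n : ℝ) + 1) := div_nonneg (by linarith) (by positivity)
  refine max_le_max le_rfl (min_le_min le_rfl ?_)
  have : (i : ℝ) ≤ j := by exact_mod_cast hij
  gcongr

theorem clampedGrid_mem (hst : s ≤ t) (n k : ℕ) : clampedGrid a b s t n k ∈ Icc s t :=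
  ⟨le_max_left _ _, max_le hst (min_le_left _ _)⟩

theorem clampedGrid_gap (hab : a ≤ b) (n k : ℕ) :
    clampedGrid a b s t n (k + 1) - clampedGrid a b s t n k ≤ (b - a) / (n + 1) := by
  have h0 : 0 ≤ (b - a) / ((n : ℝ) + 1) := div_nonneg (by linarith) (by positivity)
  have e : a + ((k + 1 : ℕ) : ℝ) * ((b - a) / (n + 1))
      = a + k * ((b - a) / (n + 1)) + (b - a) / (n + 1) := by push_cast; ring
  unfold clampedGrid
  rw [e, sub_le_iff_le_add]
  generalize (b - a) / ((n : ℝ) + 1) = d at *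
  generalize a + k * d = z
  refine max_le (by linarith [le_max_left s (min t z)]) ?_
  refine le_trans ?_ (add_le_add_right (le_max_right s (min t z)) d)
  rcases le_total t z with h | h
  · rw [min_eq_left h]; linarith [min_le_left t (z + d)]
  · rw [min_eq_right h]; linarith [min_le_right t (z + d)]

theorem eventually_control_clampedGrid_le {ρ : ℝ → ℝ → ℝ} (hρ : IsUniformControl a b ρ)
    (has : a ≤ s) (hst : s ≤ t) (htb : t ≤ b) {ε : ℝ} (hε : 0 < ε) :
    ∀ᶠ n : ℕ in Filter.atTop, ∀ k,
      ρ (clampedGrid a b s t n k) (clampedGrid a b s t n (k + 1)) ≤ ε := by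
  have hab : a ≤ b := has.trans (hst.trans htb)
  obtain ⟨η, hη, H⟩ := hρ.small ε hε
  have hlim : Filter.Tendsto (fun n : ℕ => (b - a) / ((n : ℝ) + 1)) Filter.atTop (nhds 0) :=
    by simpa [div_eq_mul_inv] using
      (tendsto_one_div_add_atTop_nhds_zero_nat (𝕜 := ℝ)).const_mul (b - a)
  filter_upwards [hlim.eventually (gt_mem_nhds hη)] with n hn k
  exact H _ _ (has.trans (clampedGrid_mem hst n k).1) (clampedGrid_mono hab n (Nat.le_succ k))
    ((clampedGrid_mem hst n _).2.trans htb) ((clampedGrid_gap hab n k).trans_lt hn)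

theorem tendsto_sum_control_clampedGrid {ρ : ℝ → ℝ → ℝ} (hρ : IsUniformControl a b ρ)
    (has : a ≤ s) (hst : s ≤ t) (htb : t ≤ b) {γ : ℝ} (hγ : 1 < γ) :
    Filter.Tendsto (fun n : ℕ => ∑ k ∈ Finset.range (n + 1),
      ρ (clampedGrid a b s t n k) (clampedGrid a b s t n (k + 1)) ^ γ)
      Filter.atTop (nhds 0) := by
  have hab : a ≤ b := has.trans (hst.trans htb)
  have hmem : ∀ n k, clampedGrid a b s t n k ∈ Icc a b := fun n k =>
    ⟨has.trans (clampedGrid_mem hst n k).1, (clampedGrid_mem hst n k).2.trans htb⟩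
  have hnn : ∀ n k, 0 ≤ ρ (clampedGrid a b s t n k) (clampedGrid a b s t n (k + 1)) :=
    fun n k => hρ.nonneg _ _ (hmem n k).1 (clampedGrid_mono hab n (Nat.le_succ k)) (hmem n _).2
  have hlim : Filter.Tendsto (fun ε : ℝ => ε ^ (γ - 1) * ρ s t) (nhdsWithin 0 (Ioi 0))
      (nhds 0) := by
    have : ContinuousAt (fun ε : ℝ => ε ^ (γ - 1) * ρ s t) 0 :=
      (Real.continuousAt_rpow_const _ _ (Or.inr (by linarith))).mul continuousAt_const
    have h2 := this.tendsto
    simp only [Real.zero_rpow (by linarith : γ - 1 ≠ 0), zero_mul] at h2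
    exact h2.mono_left nhdsWithin_le_nhds
  rw [Metric.tendsto_nhds]
  intro ξ hξ
  obtain ⟨ε, hε, hε0⟩ := ((hlim.eventually (gt_mem_nhds hξ)).and self_mem_nhdsWithin).exists
  filter_upwards [eventually_control_clampedGrid_le hρ has hst htb hε0] with n hn
  have h1 := hρ.sum_rpow_le (clampedGrid_mono hab n) (hmem n) hγ hn (n + 1)
  rw [clampedGrid_zero has hst, clampedGrid_last hst htb] at h1
  rw [Real.dist_eq, sub_zero, abs_of_nonneg
    (Finset.sum_nonneg fun k _ => Real.rpow_nonneg (hnn n k) _)]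
  exact h1.trans_lt hε

end Grid

section Sewing

variable {F : Type*} [NormedAddCommGroup F]

/-- The constant of the sewing lemma with exponent `γ`. -/
def sewingConst (γ : ℝ) : ℝ := 2 / (1 - 2 ^ (1 - γ))

theorem two_rpow_one_sub_lt_one {γ : ℝ} (hγ : 1 < γ) : (2 : ℝ) ^ (1 - γ) < 1 :=
  Real.rpow_lt_one_of_one_lt_of_neg (by norm_num) (by linarith)

theorem sewingConst_nonneg {γ : ℝ} (hγ : 1 < γ) : 0 ≤ sewingConst γ :=
  div_nonneg zero_le_two (by linarith [two_rpow_one_sub_lt_one hγ])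

/-- The two-parameter function `A` is almost additive with respect to the control `ρ`. -/
def AlmostAdditive (a b : ℝ) (ρ : ℝ → ℝ → ℝ) (γ C : ℝ) (A : ℝ → ℝ → F) : Prop :=
  ∀ s u t, a ≤ s → s ≤ u → u ≤ t → t ≤ b → ‖A s t - A s u - A u t‖ ≤ C * ρ s t ^ γ

variable {a b : ℝ} {ρ : ℝ → ℝ → ℝ} {γ C : ℝ} {A : ℝ → ℝ → F}

theorem AlmostAdditive.self (hA : AlmostAdditive a b ρ γ C A) (hρ : IsUniformControl a b ρ)
    (hγ : 1 < γ) {s : ℝ} (h1 : a ≤ s) (h2 : s ≤ b) : A s s = 0 := by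
  have := hA s s s h1 le_rfl le_rfl h2
  rw [hρ.self h1 h2, Real.zero_rpow (by linarith)] at this
  simpa using this

/-- Discrete sewing estimate. -/
theorem AlmostAdditive.norm_sum_Ico_sub_le (hA : AlmostAdditive a b ρ γ C A)
    (hρ : IsUniformControl a b ρ) (hγ : 1 < γ) {t : ℕ → ℝ} (ht : Monotone t)
    (hab : ∀ k, t k ∈ Icc a b) (n : ℕ) :
    ∀ i j, i ≤ j → j ≤ i + n →
      ‖∑ k ∈ Finset.Ico i j, A (t k) (t (k + 1)) - A (t i) (t j)‖
        ≤ sewingConst γ * C * ρ (t i) (t j) ^ γ := by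
  induction n with
  | zero =>
    intro i j h1 h2
    obtain rfl : i = j := by omega
    rw [hA.self hρ hγ (hab i).1 (hab i).2, hρ.self (hab i).1 (hab i).2,
      Real.zero_rpow (by linarith)]
    simp
  | succ n ih =>
    intro i j h1 h2
    rcases h1.eq_or_lt with rfl | hij
    · exact ih i i le_rfl (by omega)
    set r := ρ (t i) (t j) with hr
    have hr0 : 0 ≤ r := hρ.nonneg _ _ (hab i).1 (ht h1) (hab j).2
    obtain ⟨m, him, hmj, hm1, hm2⟩ : ∃ m, i ≤ m ∧ m < j ∧ ρ (t i) (t m) ≤ r / 2 ∧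
        ρ (t (m + 1)) (t j) ≤ r / 2 := by
      by_contra! hcon
      have key : ∀ k, i + k < j → ρ (t i) (t (i + k)) ≤ r / 2 := by
        intro k
        induction k with
        | zero =>
          intro _
          rw [add_zero, hρ.self (hab i).1 (hab i).2]
          linarith
        | succ k ihk =>
          intro hk
          have e1 := hcon (i + k) (by omega) (by omega) (ihk (by omega))
          have e2 := hρ.superadd (t i) (t (i + (k + 1))) (t j) (hab i).1 (ht (by omega))
            (ht (by omega)) (hab j).2
          have e3 : i + k + 1 = i + (k + 1) := by omega
          rw [e3] at e1
          linarith
      obtain ⟨k, rfl⟩ : ∃ k, j = i + k + 1 := ⟨j - i - 1, by omega⟩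
      have e1 := hcon (i + k) (by omega) (by omega) (key k (by omega))
      rw [hρ.self (hab _).1 (hab _).2] at e1
      linarith
    have hC : 0 ≤ C * r ^ γ := (norm_nonneg _).trans
      (hA (t i) (t i) (t j) (hab i).1 le_rfl (ht h1) (hab j).2)
    have hK := sewingConst_nonneg hγ
    have bound : ∀ z, 0 ≤ z → z ≤ r / 2 →
        sewingConst γ * C * z ^ γ ≤ sewingConst γ * (C * r ^ γ) * ((1 / 2) ^ γ) := by
      intro z hz0 hz
      rcases hr0.eq_or_lt with h0 | h0
      · have hz' : z = 0 := by linarith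
        rw [hz', ← h0, Real.zero_rpow (by linarith)]
        simp
      have hC0 : 0 ≤ C := nonneg_of_mul_nonneg_left hC (Real.rpow_pos_of_pos h0 _)
      calc sewingConst γ * C * z ^ γ ≤ sewingConst γ * C * (r * (1 / 2)) ^ γ := by
            gcongr
            linarith
        _ = _ := by rw [Real.mul_rpow hr0 (by norm_num)]; ring
    have e1 := (ih i m him (by omega)).trans
      (bound _ (hρ.nonneg _ _ (hab i).1 (ht him) (hab m).2) hm1)
    have e2 := (ih (m + 1) j (by omega) (by omega)).trans
      (bound _ (hρ.nonneg _ _ (hab _).1 (ht (by omega)) (hab j).2) hm2)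
    have e3 : ‖A (t i) (t j) - A (t i) (t (m + 1)) - A (t (m + 1)) (t j)‖ ≤ C * r ^ γ :=
      hA _ _ _ (hab i).1 (ht (by omega)) (ht (by omega)) (hab j).2
    have e4 : ‖A (t i) (t j) - A (t i) (t m) - A (t m) (t j)‖ ≤ C * r ^ γ :=
      hA _ _ _ (hab i).1 (ht (by omega)) (ht (by omega)) (hab j).2
    have e5 : ‖A (t m) (t j) - A (t m) (t (m + 1)) - A (t (m + 1)) (t j)‖ ≤ C * r ^ γ := by
      refine (hA _ _ _ (hab m).1 (ht (by omega)) (ht (by omega)) (hab j).2).trans ?_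
      rcases hr0.eq_or_lt with h0 | h0
      · have hz' : ρ (t m) (t j) = 0 := le_antisymm
          (h0 ▸ hρ.mono (hab i).1 (ht him) (ht hmj.le) le_rfl (hab j).2)
          (hρ.nonneg _ _ (hab m).1 (ht hmj.le) (hab j).2)
        rw [hz', ← h0]
      have hC0 : 0 ≤ C := nonneg_of_mul_nonneg_left hC (Real.rpow_pos_of_pos h0 _)
      gcongr
      · exact hρ.nonneg _ _ (hab m).1 (ht hmj.le) (hab j).2
      · exact hρ.mono (hab i).1 (ht him) (ht hmj.le) le_rfl (hab j).2
    have hsum : ∑ k ∈ Finset.Ico i j, A (t k) (t (k + 1)) =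
        ∑ k ∈ Finset.Ico i m, A (t k) (t (k + 1)) + (A (t m) (t (m + 1)) +
          ∑ k ∈ Finset.Ico (m + 1) j, A (t k) (t (k + 1))) := by
      rw [← Finset.sum_Ico_consecutive _ him hmj.le, Finset.sum_eq_sum_Ico_succ_bot hmj]
    rw [hsum]
    have split : ∑ k ∈ Finset.Ico i m, A (t k) (t (k + 1)) + (A (t m) (t (m + 1)) +
          ∑ k ∈ Finset.Ico (m + 1) j, A (t k) (t (k + 1))) - A (t i) (t j)
        = (∑ k ∈ Finset.Ico i m, A (t k) (t (k + 1)) - A (t i) (t m))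
          + (∑ k ∈ Finset.Ico (m + 1) j, A (t k) (t (k + 1)) - A (t (m + 1)) (t j))
          - (A (t i) (t j) - A (t i) (t m) - A (t m) (t j))
          - (A (t m) (t j) - A (t m) (t (m + 1)) - A (t (m + 1)) (t j)) := by abel
    rw [split]
    have hK2 : sewingConst γ * (2 * (1 / 2) ^ γ) + 2 = sewingConst γ := by
      have h2 : (2 : ℝ) * (1 / 2) ^ γ = 2 ^ (1 - γ) := by
        rw [Real.rpow_sub (by norm_num), Real.rpow_one, one_div,
          Real.inv_rpow (by norm_num), div_eq_mul_inv]
      have h3 : (1 - (2 : ℝ) ^ (1 - γ)) ≠ 0 := by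
        linarith [two_rpow_one_sub_lt_one hγ]
      rw [h2, sewingConst]
      field_simp
      ring
    calc _ ≤ sewingConst γ * (C * r ^ γ) * ((1 / 2) ^ γ)
          + sewingConst γ * (C * r ^ γ) * ((1 / 2) ^ γ) + C * r ^ γ + C * r ^ γ :=
        (norm_sub_le _ _).trans (add_le_add ((norm_sub_le _ _).trans
          (add_le_add ((norm_add_le _ _).trans (add_le_add e1 e2)) e4)) e5)
      _ = (sewingConst γ * (2 * (1 / 2) ^ γ) + 2) * (C * r ^ γ) := by ring
      _ = _ := by rw [hK2]; ring

/-- Riemann sum of `A` along the clamped grid. -/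
def gridSum (A : ℝ → ℝ → F) (a b s t : ℝ) (n : ℕ) : F :=
  ∑ k ∈ Finset.range (n + 1), A (clampedGrid a b s t n k) (clampedGrid a b s t n (k + 1))

theorem AlmostAdditive.norm_gridSum_sub_le (hA : AlmostAdditive a b ρ γ C A)
    (hρ : IsUniformControl a b ρ) (hγ : 1 < γ) {s t : ℝ} (has : a ≤ s) (hst : s ≤ t)
    (htb : t ≤ b) (n : ℕ) :
    ‖gridSum A a b s t n - A s t‖ ≤ sewingConst γ * C * ρ s t ^ γ := by
  have hab : a ≤ b := has.trans (hst.trans htb)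
  have := hA.norm_sum_Ico_sub_le hρ hγ (clampedGrid_mono (s := s) (t := t) hab n)
    (fun k => ⟨has.trans (clampedGrid_mem hst n k).1, (clampedGrid_mem hst n k).2.trans htb⟩)
    (n + 1) 0 (n + 1) (Nat.zero_le _) (by omega)
  rwa [clampedGrid_zero has hst, clampedGrid_last hst htb, ← Finset.range_eq_Ico] at this

/-- An additive function close to `A` at order `γ > 1` satisfies the sewing estimate. -/
theorem AlmostAdditive.norm_sub_sub_le (hA : AlmostAdditive a b ρ γ C A)
    (hρ : IsUniformControl a b ρ) (hγ : 1 < γ) {I : ℝ → F} {C' : ℝ}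
    (hI : ∀ s t, a ≤ s → s ≤ t → t ≤ b → ‖I t - I s - A s t‖ ≤ C' * ρ s t ^ γ)
    {s t : ℝ} (has : a ≤ s) (hst : s ≤ t) (htb : t ≤ b) :
    ‖I t - I s - A s t‖ ≤ sewingConst γ * C * ρ s t ^ γ := by
  have hab : a ≤ b := has.trans (hst.trans htb)
  have hlim := ((tendsto_sum_control_clampedGrid hρ has hst htb hγ).const_mul C').add_const
    (sewingConst γ * C * ρ s t ^ γ)
  rw [mul_zero, zero_add] at hlim
  refine ge_of_tendsto' hlim fun n => ?_
  have htel : I t - I s = ∑ k ∈ Finset.range (n + 1),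
      (I (clampedGrid a b s t n (k + 1)) - I (clampedGrid a b s t n k)) := by
    rw [Finset.sum_range_sub (fun k => I (clampedGrid a b s t n k)), clampedGrid_zero has hst,
      clampedGrid_last hst htb]
  have e1 : ‖I t - I s - gridSum A a b s t n‖ ≤ C' * ∑ k ∈ Finset.range (n + 1),
      ρ (clampedGrid a b s t n k) (clampedGrid a b s t n (k + 1)) ^ γ := by
    rw [htel, gridSum, ← Finset.sum_sub_distrib, Finset.mul_sum]
    exact norm_sum_le_of_le _ fun k _ => hI _ _ (has.trans (clampedGrid_mem hst n k).1)
      (clampedGrid_mono hab n (Nat.le_succ k)) ((clampedGrid_mem hst n _).2.trans htb)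
  have e2 := hA.norm_gridSum_sub_le hρ hγ has hst htb n
  calc ‖I t - I s - A s t‖
      = ‖(I t - I s - gridSum A a b s t n) + (gridSum A a b s t n - A s t)‖ := by
        congr 1; abel
    _ ≤ _ := (norm_add_le _ _).trans (add_le_add e1 e2)

theorem AlmostAdditive.tendsto_gridSum_add_sub (hA : AlmostAdditive a b ρ γ C A)
    (hρ : IsUniformControl a b ρ) (hγ : 1 < γ) {s u t : ℝ} (has : a ≤ s) (hsu : s ≤ u)
    (hut : u ≤ t) (htb : t ≤ b) :
    Filter.Tendsto (fun n => gridSum A a b s t n - gridSum A a b s u n - gridSum A a b u t n)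
      Filter.atTop (nhds 0) := by
  have hst := hsu.trans hut
  have hab : a ≤ b := has.trans (hst.trans htb)
  have hlim := (tendsto_sum_control_clampedGrid hρ has hst htb hγ).const_mul C
  rw [mul_zero] at hlim
  refine squeeze_zero_norm (fun n => ?_) hlim
  rw [gridSum, gridSum, gridSum, ← Finset.sum_sub_distrib, ← Finset.sum_sub_distrib,
    Finset.mul_sum]
  refine norm_sum_le_of_le _ fun k _ => ?_
  have hmin : ∀ k, clampedGrid a b s u n k = min (clampedGrid a b s t n k) u := fun k => by
    simp only [clampedGrid]
    generalize a + (k : ℝ) * ((b - a) / (n + 1)) = z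
    rw [min_max_distrib_right, min_eq_left hsu, min_right_comm, min_eq_right hut]
  have hmax : ∀ k, clampedGrid a b u t n k = max (clampedGrid a b s t n k) u := fun k => by
    simp only [clampedGrid]
    generalize a + (k : ℝ) * ((b - a) / (n + 1)) = z
    rw [max_right_comm, max_eq_right hsu]
  rw [hmin, hmin, hmax, hmax]
  have hmem : ∀ k, clampedGrid a b s t n k ∈ Icc a b := fun k =>
    ⟨has.trans (clampedGrid_mem hst n k).1, (clampedGrid_mem hst n k).2.trans htb⟩
  have hle := clampedGrid_mono (s := s) (t := t) hab n (Nat.le_succ k)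
  have h1 := hmem k
  have h2 := hmem (k + 1)
  change clampedGrid a b s t n k ≤ clampedGrid a b s t n (k + 1) at hle
  generalize clampedGrid a b s t n k = v at *
  generalize clampedGrid a b s t n (k + 1) = w at *
  have hnn : 0 ≤ C * ρ v w ^ γ := (norm_nonneg _).trans (hA v v w h1.1 le_rfl hle h2.2)
  have huu := hA.self hρ hγ (has.trans hsu) (hut.trans htb)
  rcases le_total w u with hwu | hwu
  · rw [min_eq_left hwu, min_eq_left (hle.trans hwu), max_eq_right hwu,
      max_eq_right (hle.trans hwu), huu]
    simpa using hnn
  · rcases le_total u v with huv | huv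
    · rw [min_eq_right hwu, min_eq_right huv, max_eq_left hwu, max_eq_left huv, huu]
      simpa using hnn
    · rw [min_eq_right hwu, min_eq_left huv, max_eq_left hwu, max_eq_right huv]
      exact hA v u w h1.1 huv hwu h2.2

/-- Sewing lemma: existence of an additive function close to an almost additive one. -/
theorem AlmostAdditive.exists_sewing [ProperSpace F] (hA : AlmostAdditive a b ρ γ C A)
    (hρ : IsUniformControl a b ρ) (hγ : 1 < γ) :
    ∃ I : ℝ → F, ∀ s t, a ≤ s → s ≤ t → t ≤ b →
      ‖I t - I s - A s t‖ ≤ sewingConst γ * C * ρ s t ^ γ := by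
  have hlim : ∀ t, ∃ v, t ∈ Icc a b → Filter.Tendsto (fun n => gridSum A a b a t n)
      (Filter.hyperfilter ℕ : Filter ℕ) (nhds v) := by
    intro t
    by_cases ht : t ∈ Icc a b
    · obtain ⟨v, -, hv⟩ := (isCompact_closedBall (A a t)
        (sewingConst γ * C * ρ a t ^ γ)).ultrafilter_le_nhds
        ((Filter.hyperfilter ℕ).map (fun n => gridSum A a b a t n)) (by
          rw [Filter.le_principal_iff]
          refine Filter.Eventually.of_forall (f := (Filter.hyperfilter ℕ : Filter ℕ))
            fun n => ?_
          rw [Metric.mem_closedBall, dist_eq_norm]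
          exact hA.norm_gridSum_sub_le hρ hγ le_rfl ht.1 ht.2 n)
      exact ⟨v, fun _ => hv⟩
    · exact ⟨0, fun h => absurd h ht⟩
  choose I hI using hlim
  refine ⟨I, fun s t has hst htb => ?_⟩
  have h1 := (hA.tendsto_gridSum_add_sub hρ hγ le_rfl has hst htb).mono_left
    (Nat.hyperfilter_le_atTop)
  have h2 := (((hI t ⟨has.trans hst, htb⟩).sub (hI s ⟨has, hst.trans htb⟩)).sub_const
    (A s t)).sub h1
  rw [sub_zero] at h2
  refine le_of_tendsto' h2.norm fun n => ?_
  refine le_trans (le_of_eq ?_) (hA.norm_gridSum_sub_le hρ hγ has hst htb n)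
  congr 1
  abel

end Sewing

section Young

variable {E F : Type*} [NormedAddCommGroup E] [NormedSpace ℝ E]
  [NormedAddCommGroup F] [NormedSpace ℝ F]

theorem TaggedPartition.sub_le_mesh {a b : ℝ} (P : TaggedPartition a b) (i : Fin P.n) :
    P.t i.succ - P.t i.castSucc ≤ P.mesh :=
  le_ciSup (f := fun i : Fin P.n => P.t i.succ - P.t i.castSucc)
    (Set.finite_range _).bddAbove i

/-- The points of a tagged partition as a stationary sequence. -/
def TaggedPartition.seq {a b : ℝ} (P : TaggedPartition a b) (k : ℕ) : ℝ :=
  P.t ⟨min k P.n, by omega⟩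

theorem TaggedPartition.seq_mono {a b : ℝ} (P : TaggedPartition a b) : Monotone P.seq := by
  intro i j hij
  refine P.mono.monotone ?_
  rw [Fin.mk_le_mk]
  omega

theorem TaggedPartition.seq_zero {a b : ℝ} (P : TaggedPartition a b) : P.seq 0 = a := by
  refine Eq.trans ?_ P.first
  rw [seq]
  congr 1

theorem TaggedPartition.seq_of_le {a b : ℝ} (P : TaggedPartition a b) {k : ℕ} (hk : P.n ≤ k) :
    P.seq k = b := by
  refine Eq.trans ?_ P.last
  rw [seq]
  congr 1
  ext
  simp [hk]

theorem TaggedPartition.seq_castSucc {a b : ℝ} (P : TaggedPartition a b) (i : Fin P.n) :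
    P.seq i = P.t i.castSucc := by
  rw [seq]
  congr 1
  ext
  simp [i.2.le]

theorem TaggedPartition.seq_succ {a b : ℝ} (P : TaggedPartition a b) (i : Fin P.n) :
    P.seq (i + 1) = P.t i.succ := by
  rw [seq]
  congr 1
  ext
  simp only [Fin.val_succ]
  have := i.2
  omega

theorem TaggedPartition.seq_mem {a b : ℝ} (P : TaggedPartition a b) (k : ℕ) :
    P.seq k ∈ Icc a b :=
  ⟨P.seq_zero.ge.trans (P.seq_mono (Nat.zero_le k)),
    (P.seq_mono (le_max_left k P.n)).trans (P.seq_of_le (le_max_right k P.n)).le⟩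

theorem TaggedPartition.exists_mesh_lt {a b : ℝ} (hab : a ≤ b) {η : ℝ} (hη : 0 < η) :
    ∃ P : TaggedPartition a b, P.mesh < η := by
  rcases hab.eq_or_lt with rfl | hlt
  · refine ⟨⟨0, fun _ => a, Fin.elim0, ?_, rfl, rfl, fun i => i.elim0⟩, ?_⟩
    · intro i j hij
      exact absurd hij (by omega)
    · simpa [mesh] using hη
  · obtain ⟨n, hn⟩ := exists_nat_gt ((b - a) / η)
    have hpos : 0 < (b - a) / (n + 1) := div_pos (by linarith) (by positivity)
    have hstep : (b - a) / (n + 1) < η := by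
      rw [div_lt_iff₀ hη] at hn
      rw [div_lt_iff₀ (by positivity)]
      nlinarith
    have hgap : ∀ i : Fin (n + 1), (a + ((i.succ : ℕ) : ℝ) * ((b - a) / (n + 1)))
        - (a + ((i.castSucc : ℕ) : ℝ) * ((b - a) / (n + 1))) = (b - a) / (n + 1) := by
      intro i
      simp only [Fin.val_succ, Fin.val_castSucc]
      push_cast
      ring
    refine ⟨⟨n + 1, fun i => a + (i : ℕ) * ((b - a) / (n + 1)),
      fun i => a + ((i.castSucc : ℕ) : ℝ) * ((b - a) / (n + 1)), ?_, by simp, ?_,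
      fun i => ⟨le_rfl, ?_⟩⟩, ?_⟩
    · intro i j hij
      have : (i : ℝ) < j := by exact_mod_cast hij
      simp only
      gcongr
    · simp only [Fin.val_last]
      push_cast
      field_simp
      ring
    · linarith [hgap i]
    · simp only [mesh]
      simp_rw [hgap]
      simpa using hstep

theorem IsYoungIntegral.youngIntegral_eq {x : ℝ → E →L[ℝ] F} {ω : ℝ → E} {a b : ℝ} {v : F}
    (hab : a ≤ b) (hv : IsYoungIntegral x ω a b v) : youngIntegral x ω a b = v := by
  have hex : ∃ v, IsYoungIntegral x ω a b v := ⟨v, hv⟩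
  have hc : IsYoungIntegral x ω a b (youngIntegral x ω a b) := by
    rw [youngIntegral, dif_pos hex]
    exact hex.choose_spec
  by_contra hne
  have hpos : 0 < ‖youngIntegral x ω a b - v‖ / 2 := half_pos (norm_pos_iff.2 (sub_ne_zero.2 hne))
  obtain ⟨δ₁, h1, H1⟩ := hv _ hpos
  obtain ⟨δ₂, h2, H2⟩ := hc _ hpos
  obtain ⟨P, hP⟩ := TaggedPartition.exists_mesh_lt hab (lt_min h1 h2)
  have e1 := H1 P (hP.trans_le (min_le_left _ _))
  have e2 := H2 P (hP.trans_le (min_le_right _ _))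
  have e3 : ‖youngIntegral x ω a b - v‖
      ≤ ‖RSSum x ω P - v‖ + ‖RSSum x ω P - youngIntegral x ω a b‖ := by
    rw [show youngIntegral x ω a b - v
      = (RSSum x ω P - v) - (RSSum x ω P - youngIntegral x ω a b) by abel]
    exact norm_sub_le _ _
  linarith

theorem IsUniformControl.almostAdditive {a b : ℝ} {ρ : ℝ → ℝ → ℝ} (hρ : IsUniformControl a b ρ)
    {Y : ℝ → E →L[ℝ] F} {ω : ℝ → E} {θ κ C : ℝ} (hC : 0 ≤ C) (hθ : 0 ≤ θ) (hκ : 0 ≤ κ)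
    (hY : ∀ s t, a ≤ s → s ≤ t → t ≤ b → ‖Y t - Y s‖ ≤ C * ρ s t ^ θ)
    (hω : ∀ s t, a ≤ s → s ≤ t → t ≤ b → ‖ω t - ω s‖ ≤ ρ s t ^ κ) :
    AlmostAdditive a b ρ (θ + κ) C (fun s t => Y s (ω t - ω s)) := by
  intro s u t h1 h2 h3 h4
  have e : Y s (ω t - ω s) - Y s (ω u - ω s) - Y u (ω t - ω u) = -((Y u - Y s) (ω t - ω u)) := by
    simp only [map_sub, sub_apply]
    abel
  have h0 : 0 ≤ ρ s t := hρ.nonneg s t h1 (h2.trans h3) h4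
  simp only
  rw [e, norm_neg, Real.rpow_add_of_nonneg h0 hθ hκ, ← mul_assoc]
  refine ((Y u - Y s).le_opNorm _).trans ?_
  refine mul_le_mul ((hY s u h1 h2 (h3.trans h4)).trans ?_)
    ((hω u t (h1.trans h2) h3 h4).trans ?_) (norm_nonneg _) (by positivity)
  · exact mul_le_mul_of_nonneg_left (Real.rpow_le_rpow (hρ.nonneg _ _ h1 h2 (h3.trans h4))
      (hρ.mono h1 le_rfl h2 h3 h4) hθ) hC
  · exact Real.rpow_le_rpow (hρ.nonneg _ _ (h1.trans h2) h3 h4)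
      (hρ.mono h1 h2 h3 le_rfl h4) hκ

/-- A function sewn from `Y s (ω t - ω s)` is an indefinite Young integral. -/
theorem IsUniformControl.isYoungIntegral {a b : ℝ} {ρ : ℝ → ℝ → ℝ}
    (hρ : IsUniformControl a b ρ)
    {Y : ℝ → E →L[ℝ] F} {ω : ℝ → E} {θ κ C C' : ℝ} (hC : 0 ≤ C) (hC' : 0 ≤ C')
    (hθ : 0 ≤ θ) (hκ : 0 ≤ κ) (hθκ : 1 < θ + κ)
    (hY : ∀ s t, a ≤ s → s ≤ t → t ≤ b → ‖Y t - Y s‖ ≤ C * ρ s t ^ θ)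
    (hω : ∀ s t, a ≤ s → s ≤ t → t ≤ b → ‖ω t - ω s‖ ≤ ρ s t ^ κ)
    {I : ℝ → F} (hI : ∀ s t, a ≤ s → s ≤ t → t ≤ b →
      ‖I t - I s - Y s (ω t - ω s)‖ ≤ C' * ρ s t ^ (θ + κ)) :
    IsYoungIntegral Y ω a b (I b - I a) := by
  intro ξ hξ
  have hlim : Filter.Tendsto (fun ε : ℝ => (C + C') * (ε ^ (θ + κ - 1) * ρ a b))
      (nhdsWithin 0 (Ioi 0)) (nhds 0) := by
    have : ContinuousAt (fun ε : ℝ => (C + C') * (ε ^ (θ + κ - 1) * ρ a b)) 0 :=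
      continuousAt_const.mul
        ((Real.continuousAt_rpow_const _ _ (Or.inr (by linarith))).mul continuousAt_const)
    have h2 := this.tendsto
    simp only [Real.zero_rpow (by linarith : θ + κ - 1 ≠ 0), zero_mul, mul_zero] at h2
    exact h2.mono_left nhdsWithin_le_nhds
  obtain ⟨ε, hε, hε0⟩ := ((hlim.eventually (gt_mem_nhds hξ)).and self_mem_nhdsWithin).exists
  obtain ⟨η, hη, H⟩ := hρ.small ε hε0
  refine ⟨η, hη, fun P hP => lt_of_le_of_lt ?_ hε⟩
  have hsmall : ∀ k, ρ (P.seq k) (P.seq (k + 1)) ≤ ε := by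
    intro k
    refine H _ _ (P.seq_mem k).1 (P.seq_mono (Nat.le_succ k)) (P.seq_mem _).2 ?_
    rcases lt_or_ge k P.n with hk | hk
    · have e1 := P.seq_castSucc ⟨k, hk⟩
      have e2 := P.seq_succ ⟨k, hk⟩
      simp only at e1 e2
      rw [e1, e2]
      exact (P.sub_le_mesh _).trans_lt hP
    · rw [P.seq_of_le hk, P.seq_of_le (hk.trans (Nat.le_succ k)), sub_self]
      exact hη
  have htel : I b - I a = ∑ i : Fin P.n, (I (P.t i.succ) - I (P.t i.castSucc)) := by
    have h1 := Finset.sum_range_sub (fun k => I (P.seq k)) P.n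
    rw [P.seq_zero, P.seq_of_le le_rfl, Finset.sum_range] at h1
    simp_rw [P.seq_castSucc, P.seq_succ] at h1
    exact h1.symm
  have hsum := hρ.sum_rpow_le P.seq_mono P.seq_mem hθκ hsmall P.n
  rw [P.seq_zero, P.seq_of_le le_rfl, Finset.sum_range] at hsum
  simp_rw [P.seq_castSucc, P.seq_succ] at hsum
  refine le_trans ?_ (mul_le_mul_of_nonneg_left hsum (add_nonneg hC hC'))
  rw [RSSum, htel, ← Finset.sum_sub_distrib, Finset.mul_sum]
  refine norm_sum_le_of_le _ fun i _ => ?_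
  have hu := P.tag_mem i
  have hs : a ≤ P.t i.castSucc := P.seq_castSucc i ▸ (P.seq_mem _).1
  have ht : P.t i.succ ≤ b := P.seq_succ i ▸ (P.seq_mem _).2
  generalize P.t i.castSucc = s at *
  generalize P.t i.succ = t at *
  generalize P.tag i = u at *
  have hst : s ≤ t := hu.1.trans hu.2
  have h0 : 0 ≤ ρ s t := hρ.nonneg s t hs hst ht
  have e1 : Y u (ω t - ω s) - (I t - I s)
      = (Y u - Y s) (ω t - ω s) - (I t - I s - Y s (ω t - ω s)) := by
    simp only [sub_apply]
    abel
  have e2 : ‖(Y u - Y s) (ω t - ω s)‖ ≤ C * ρ s t ^ (θ + κ) := by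
    rw [Real.rpow_add_of_nonneg h0 hθ hκ, ← mul_assoc]
    refine ((Y u - Y s).le_opNorm _).trans ?_
    refine mul_le_mul ((hY s u hs hu.1 (hu.2.trans ht)).trans ?_) (hω s t hs hst ht)
      (norm_nonneg _) (by positivity)
    exact mul_le_mul_of_nonneg_left (Real.rpow_le_rpow (hρ.nonneg _ _ hs hu.1 (hu.2.trans ht))
      (hρ.mono hs le_rfl hu.1 hu.2 ht) hθ) hC
  rw [e1, add_mul]
  exact (norm_sub_le _ _).trans (add_le_add e2 (hI s t hs hst ht))

theorem IsUniformControl.exists_youngIntegral [ProperSpace F] {a b : ℝ} {ρ : ℝ → ℝ → ℝ}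
    (hρ : IsUniformControl a b ρ)
    {Y : ℝ → E →L[ℝ] F} {ω : ℝ → E} {θ κ C : ℝ} (hC : 0 ≤ C)
    (hθ : 0 ≤ θ) (hκ : 0 ≤ κ) (hθκ : 1 < θ + κ)
    (hY : ∀ s t, a ≤ s → s ≤ t → t ≤ b → ‖Y t - Y s‖ ≤ C * ρ s t ^ θ)
    (hω : ∀ s t, a ≤ s → s ≤ t → t ≤ b → ‖ω t - ω s‖ ≤ ρ s t ^ κ) :
    ∀ s t, a ≤ s → s ≤ t → t ≤ b →
      ‖youngIntegral Y ω a t - youngIntegral Y ω a s - Y s (ω t - ω s)‖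
        ≤ sewingConst (θ + κ) * C * ρ s t ^ (θ + κ) := by
  obtain ⟨I, hI⟩ := (hρ.almostAdditive hC hθ hκ hY hω).exists_sewing hρ hθκ
  have key : ∀ t, a ≤ t → t ≤ b → youngIntegral Y ω a t = I t - I a := by
    intro t hat htb
    refine IsYoungIntegral.youngIntegral_eq hat ?_
    exact (hρ.restrict le_rfl htb).isYoungIntegral hC
      (mul_nonneg (sewingConst_nonneg hθκ) hC) hθ hκ hθκ
      (fun s t' h1 h2 h3 => hY s t' h1 h2 (h3.trans htb))
      (fun s t' h1 h2 h3 => hω s t' h1 h2 (h3.trans htb))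
      (fun s t' h1 h2 h3 => hI s t' h1 h2 (h3.trans htb))
  intro s t has hst htb
  rw [key t (has.trans hst) htb, key s has (hst.trans htb),
    sub_sub_sub_cancel_right]
  exact hI s t has hst htb

end Young

section Variation

variable {E : Type*} [NormedAddCommGroup E] {p a b c : ℝ} {x : ℝ → E}

theorem zero_mem_pVarSums (p : ℝ) (x : ℝ → E) (a : ℝ) : (0 : ℝ) ∈ pVarSums p x a a :=
  ⟨0, fun _ => a, fun i j hij => absurd hij (by omega), rfl, rfl,
    by simp⟩

theorem pVarSums_snoc {v : ℝ} (hv : v ∈ pVarSums p x a b) (hbc : b < c) :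
    v + ‖x c - x b‖ ^ p ∈ pVarSums p x a c := by
  obtain ⟨n, t, ht, h0, hl, rfl⟩ := hv
  refine ⟨n + 1, Fin.snoc (α := fun _ => ℝ) t c, ?_, ?_, Fin.snoc_last _ _, ?_⟩
  · refine Fin.strictMono_iff_lt_succ.2 fun i => ?_
    refine Fin.lastCases ?_ (fun j => ?_) i
    · rw [Fin.succ_last, Fin.snoc_last, Fin.snoc_castSucc, hl]
      exact hbc
    · rw [Fin.succ_castSucc, Fin.snoc_castSucc, Fin.snoc_castSucc]
      exact ht Fin.castSucc_lt_succ
  · rw [← Fin.castSucc_zero, Fin.snoc_castSucc, h0]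
  · rw [Fin.sum_univ_castSucc, Fin.succ_last, Fin.snoc_last, Fin.snoc_castSucc, hl]
    simp_rw [Fin.succ_castSucc, Fin.snoc_castSucc]

theorem pVarSums_add {v w : ℝ} (hv : v ∈ pVarSums p x a b) (hw : w ∈ pVarSums p x b c) :
    v + w ∈ pVarSums p x a c := by
  obtain ⟨n, t, ht, h0, hl, rfl⟩ := hw
  induction n generalizing c with
  | zero =>
    have : b = c := by rw [← h0, ← hl]; rfl
    subst this
    simpa using hv
  | succ n ih =>
    have h1 := ih (c := t (Fin.last n).castSucc) (fun i => t i.castSucc)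
      (ht.comp Fin.strictMono_castSucc) h0 rfl
    have h2 := pVarSums_snoc h1 (c := c) (by
      rw [← hl]
      exact ht (Fin.castSucc_lt_last _))
    rw [Fin.sum_univ_castSucc, ← add_assoc]
    rw [← hl] at h2 ⊢
    simpa only [Fin.succ_castSucc, Fin.succ_last] using h2

theorem pVarSums_nonneg {v : ℝ} (hv : v ∈ pVarSums p x a b) : 0 ≤ v := by
  obtain ⟨n, t, -, -, -, rfl⟩ := hv
  exact Finset.sum_nonneg fun i _ => Real.rpow_nonneg (norm_nonneg _) _

theorem norm_rpow_mem_pVarSums (hab : a < b) : ‖x b - x a‖ ^ p ∈ pVarSums p x a b := by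
  simpa using pVarSums_snoc (zero_mem_pVarSums p x a) hab

theorem pVarSums_nonempty (hab : a ≤ b) : (pVarSums p x a b).Nonempty := by
  rcases hab.eq_or_lt with rfl | hlt
  · exact ⟨0, zero_mem_pVarSums p x a⟩
  · exact ⟨_, norm_rpow_mem_pVarSums hlt⟩

theorem FinitePVar.exists_bound (hx : FinitePVar p x a b) (hab : a ≤ b) :
    ∃ B, 0 ≤ B ∧ ∀ s t, a ≤ s → s ≤ t → t ≤ b → ∀ v ∈ pVarSums p x s t, v ≤ B := by
  obtain ⟨B, hB⟩ := hx
  obtain ⟨v₀, hv₀⟩ := pVarSums_nonempty (p := p) (x := x) hab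
  refine ⟨B, (pVarSums_nonneg hv₀).trans (hB hv₀), fun s t has hst htb v hv => ?_⟩
  obtain ⟨v₁, hv₁⟩ := pVarSums_nonempty (p := p) (x := x) has
  obtain ⟨v₂, hv₂⟩ := pVarSums_nonempty (p := p) (x := x) htb
  have := hB (pVarSums_add (pVarSums_add hv₁ hv) hv₂)
  linarith [pVarSums_nonneg hv₁, pVarSums_nonneg hv₂]

/-- Interpolation: passing to a larger exponent gains a power of the oscillation. -/
theorem le_mul_of_mem_pVarSums {r D B v : ℝ} (hp : 0 < p) (hpr : p < r)
    (hD : ∀ s ∈ Icc a b, ∀ t ∈ Icc a b, ‖x t - x s‖ ≤ D) (hD0 : 0 ≤ D)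
    (hB : ∀ v ∈ pVarSums p x a b, v ≤ B) (hv : v ∈ pVarSums r x a b) :
    v ≤ D ^ (r - p) * B := by
  obtain ⟨n, t, ht, h0, hl, rfl⟩ := hv
  have hmem : ∀ i, t i ∈ Icc a b := fun i =>
    ⟨h0 ▸ ht.monotone (Fin.zero_le i), hl ▸ ht.monotone (Fin.le_last i)⟩
  refine le_trans ?_ (mul_le_mul_of_nonneg_left (hB _ ⟨n, t, ht, h0, hl, rfl⟩)
    (Real.rpow_nonneg hD0 _))
  rw [Finset.mul_sum]
  refine Finset.sum_le_sum fun i _ => ?_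
  have e : ‖x (t i.succ) - x (t i.castSucc)‖ ^ r
      = ‖x (t i.succ) - x (t i.castSucc)‖ ^ (r - p) * ‖x (t i.succ) - x (t i.castSucc)‖ ^ p := by
    rw [← Real.rpow_add_of_nonneg (norm_nonneg _) (by linarith) hp.le, sub_add_cancel]
  rw [e]
  have := hD _ (hmem i.castSucc) _ (hmem i.succ)
  gcongr

/-- A continuous path of finite `p`-variation is dominated by a uniform control at every
larger exponent. -/
theorem FinitePVar.exists_control (hab : a ≤ b) (hx : FinitePVar p x a b)
    (hc : ContinuousOn x (Icc a b)) {r : ℝ} (hp : 0 < p) (hpr : p < r) :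
    ∃ ρ, IsUniformControl a b ρ ∧
      ∀ s t, a ≤ s → s ≤ t → t ≤ b → ‖x t - x s‖ ≤ ρ s t ^ (1 / r) := by
  obtain ⟨B, hB0, hB⟩ := hx.exists_bound hab
  obtain ⟨N, hN⟩ := isCompact_Icc.exists_bound_of_continuousOn hc
  have hN0 : 0 ≤ N := (norm_nonneg _).trans (hN a ⟨le_rfl, hab⟩)
  have hbdd : ∀ s t, a ≤ s → s ≤ t → t ≤ b → BddAbove (pVarSums r x s t) := by
    intro s t has hst htb
    refine ⟨(2 * N) ^ (r - p) * B, fun v hv => le_mul_of_mem_pVarSums hp hpr ?_ (by linarith)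
      (hB s t has hst htb) hv⟩
    intro u hu w hw
    have e1 := hN u ⟨has.trans hu.1, hu.2.trans htb⟩
    have e2 := hN w ⟨has.trans hw.1, hw.2.trans htb⟩
    linarith [norm_sub_le (x w) (x u)]
  have hnn : ∀ s t, a ≤ s → s ≤ t → t ≤ b → 0 ≤ sSup (pVarSums r x s t) :=
    fun s t _ _ _ => Real.sSup_nonneg fun v hv => pVarSums_nonneg hv
  refine ⟨fun s t => sSup (pVarSums r x s t), ⟨hnn, ?_, ?_⟩, ?_⟩
  · intro s u t h1 h2 h3 h4
    have key : ∀ v ∈ pVarSums r x s u,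
        v ≤ sSup (pVarSums r x s t) - sSup (pVarSums r x u t) := by
      intro v hv
      have : sSup (pVarSums r x u t) ≤ sSup (pVarSums r x s t) - v :=
        csSup_le (pVarSums_nonempty h3) fun w hw => by
          linarith [le_csSup (hbdd s t h1 (h2.trans h3) h4) (pVarSums_add hv hw)]
      linarith
    linarith [csSup_le (pVarSums_nonempty h2) key]
  · intro ε hε
    have hlim : Filter.Tendsto (fun D : ℝ => D ^ (r - p) * B) (nhdsWithin 0 (Ioi 0))
        (nhds 0) := by
      have : ContinuousAt (fun D : ℝ => D ^ (r - p) * B) 0 :=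
        (Real.continuousAt_rpow_const _ _ (Or.inr (by linarith))).mul continuousAt_const
      have h2 := this.tendsto
      simp only [Real.zero_rpow (by linarith : r - p ≠ 0), zero_mul] at h2
      exact h2.mono_left nhdsWithin_le_nhds
    obtain ⟨D, hD, hD0⟩ := ((hlim.eventually (gt_mem_nhds hε)).and self_mem_nhdsWithin).exists
    have hu := isCompact_Icc.uniformContinuousOn_of_continuous hc
    rw [Metric.uniformContinuousOn_iff] at hu
    obtain ⟨η, hη, H⟩ := hu D hD0
    refine ⟨η, hη, fun s t h1 h2 h3 h4 => csSup_le (pVarSums_nonempty h2) fun v hv => ?_⟩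
    refine (le_mul_of_mem_pVarSums hp hpr ?_ (le_of_lt hD0) (hB s t h1 h2 h3) hv).trans hD.le
    intro u hu w hw
    rw [← dist_eq_norm]
    refine (H w ⟨h1.trans hw.1, hw.2.trans h3⟩ u ⟨h1.trans hu.1, hu.2.trans h3⟩ ?_).le
    rw [Real.dist_eq, abs_lt]
    constructor <;> linarith [hu.1, hu.2, hw.1, hw.2]
  · intro s t h1 h2 h3
    rcases h2.eq_or_lt with rfl | hlt
    · simpa using Real.rpow_nonneg (hnn s s h1 le_rfl h3) _
    have hr : 0 < r := hp.trans hpr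
    have := le_csSup (hbdd s t h1 h2 h3) (norm_rpow_mem_pVarSums hlt)
    calc ‖x t - x s‖ = (‖x t - x s‖ ^ r) ^ (1 / r) := by
          rw [← Real.rpow_mul (norm_nonneg _), mul_one_div_cancel hr.ne', Real.rpow_one]
      _ ≤ _ := Real.rpow_le_rpow (Real.rpow_nonneg (norm_nonneg _) _) this (by positivity)

end Variation

section Uniqueness

/-- If `r ≤ B`, then lowering the exponent of `r` costs a power of `B`. -/
theorem rpow_le_rpow_sub_mul_rpow {r B c e : ℝ} (hr : 0 ≤ r) (hrB : r ≤ B) (hc : 0 < c)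
    (hce : c ≤ e) : r ^ e ≤ B ^ (e - c) * r ^ c := by
  calc r ^ e = r ^ (e - c) * r ^ c := by
        rw [← Real.rpow_add_of_nonneg hr (by linarith) hc.le, sub_add_cancel]
    _ ≤ _ := mul_le_mul_of_nonneg_right (Real.rpow_le_rpow hr hrB (by linarith))
      (Real.rpow_nonneg hr _)

/-- Four-point estimate for a pair of differentiable maps. -/
theorem norm_four_point_le {E F : Type*} [NormedAddCommGroup E] [NormedSpace ℝ E]
    [NormedAddCommGroup F] [NormedSpace ℝ F] {φ ψ : E → F} {φ' ψ' : E → E →L[ℝ] F}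
    (hφ : ∀ x, HasFDerivAt φ (φ' x) x) (hψ : ∀ x, HasFDerivAt ψ (ψ' x) x) {L H : ℝ}
    (hL : ∀ x, ‖φ' x‖ ≤ L) {x y z w : E}
    (hH : ∀ θ ∈ Icc (0 : ℝ) 1, ‖φ' (y + θ • (x - y)) - ψ' (w + θ • (z - w))‖ ≤ H) :
    ‖(φ x - φ y) - (ψ z - ψ w)‖ ≤ L * ‖(x - y) - (z - w)‖ + H * ‖z - w‖ := by
  have hline : ∀ (p v : E) (θ : ℝ), HasDerivAt (fun θ : ℝ => p + θ • v) v θ := fun p v θ => by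
    simpa using ((hasDerivAt_id θ).smul_const v).const_add p
  have hd : ∀ θ : ℝ, HasDerivAt (fun θ : ℝ => φ (y + θ • (x - y)) - ψ (w + θ • (z - w)))
      (φ' (y + θ • (x - y)) (x - y) - ψ' (w + θ • (z - w)) (z - w)) θ := fun θ =>
    ((hφ _).comp_hasDerivAt θ (hline y (x - y) θ)).sub
      ((hψ _).comp_hasDerivAt θ (hline w (z - w) θ))
  have := norm_image_sub_le_of_norm_deriv_le_segment_01'
    (C := L * ‖(x - y) - (z - w)‖ + H * ‖z - w‖)
    (fun θ _ => (hd θ).hasDerivWithinAt) (fun θ hθ => by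
      have e : φ' (y + θ • (x - y)) (x - y) - ψ' (w + θ • (z - w)) (z - w)
          = φ' (y + θ • (x - y)) ((x - y) - (z - w))
            + (φ' (y + θ • (x - y)) - ψ' (w + θ • (z - w))) (z - w) := by
        simp only [map_sub, sub_apply]
        abel
      rw [e]
      exact (norm_add_le _ _).trans (add_le_add
        (((φ' _).le_opNorm _).trans (mul_le_mul_of_nonneg_right (hL _) (norm_nonneg _)))
        ((ContinuousLinearMap.le_opNorm _ _).trans
          (mul_le_mul_of_nonneg_right (hH θ (Ico_subset_Icc_self hθ)) (norm_nonneg _)))))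
  simp only [one_smul, zero_smul, add_zero, add_sub_cancel] at this
  refine le_trans (le_of_eq ?_) this
  congr 1
  abel

/-- Contraction on a short interval: a path driven by a linear Young equation and vanishing
at one point vanishes identically. -/
theorem IsUniformControl.eq_zero_of_contraction {E F : Type*} [NormedAddCommGroup E]
    [NormedSpace ℝ E] [NormedAddCommGroup F] [NormedSpace ℝ F] {a b : ℝ} {ρ : ℝ → ℝ → ℝ}
    (hρ : IsUniformControl a b ρ) {u J : ℝ → F} {G : ℝ → E →L[ℝ] F} {ω : ℝ → E}
    {κ θ π L Lg C C' R ε : ℝ} (hκ : 0 < κ) (hκ1 : κ ≤ 1) (hκπ : κ ≤ π) (hθ : 0 < θ)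
    (hθκ : θ ≤ κ) (hθπ : 1 < θ + π) (hL : 0 ≤ L) (hLg : 0 ≤ Lg) (hC : 0 ≤ C) (hR : 0 ≤ R)
    (hlen : ∀ s t, a ≤ s → s ≤ t → t ≤ b → t - s ≤ ρ s t)
    (hω : ∀ s t, a ≤ s → s ≤ t → t ≤ b → ‖ω t - ω s‖ ≤ ρ s t ^ π)
    (hu : ∀ s t, a ≤ s → s ≤ t → t ≤ b → ‖u t - u s‖ ≤ R * ρ s t ^ κ)
    (hJ : ∀ s t, a ≤ s → s ≤ t → t ≤ b →
      ‖J t - J s - G s (ω t - ω s)‖ ≤ C' * ρ s t ^ (θ + π))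
    (hdrift : ∀ M, (∀ r ∈ Icc a b, ‖u r‖ ≤ M) → ∀ s t, a ≤ s → s ≤ t → t ≤ b →
      ‖(u t - u s) - (J t - J s)‖ ≤ L * M * (t - s))
    (hG0 : ∀ s ∈ Icc a b, ‖G s‖ ≤ Lg * ‖u s‖)
    (hG : ∀ s t, a ≤ s → s ≤ t → t ≤ b →
      ‖G t - G s‖ ≤ Lg * ‖u t - u s‖ + C * ρ s t ^ θ * ‖u s‖)
    (hε1 : ε ≤ 1) (hρε : ρ a b ≤ ε)
    (hcontr : (L + Lg) * ε ^ κ + sewingConst (θ + π) * (Lg + C) * ε ^ (θ + π - κ) ≤ 1 / 2)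
    {r : ℝ} (hr : r ∈ Icc a b) (hur : u r = 0) : ∀ s ∈ Icc a b, u s = 0 := by
  have hε0 : 0 ≤ ε := (hρ.nonneg a b le_rfl (hr.1.trans hr.2) le_rfl).trans hρε
  have hρle : ∀ s t, a ≤ s → s ≤ t → t ≤ b → ρ s t ≤ ε := fun s t h1 h2 h3 =>
    (hρ.mono le_rfl h1 h2 h3 le_rfl).trans hρε
  have hsup : ∀ R, 0 ≤ R →
      (∀ s t, a ≤ s → s ≤ t → t ≤ b → ‖u t - u s‖ ≤ R * ρ s t ^ κ) →
      ∀ s ∈ Icc a b, ‖u s‖ ≤ R * ε ^ κ := by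
    intro R hR hu s hs
    rcases le_total r s with h | h
    · have := hu r s hr.1 h hs.2
      rw [hur, sub_zero] at this
      refine this.trans (mul_le_mul_of_nonneg_left (Real.rpow_le_rpow
        (hρ.nonneg _ _ hr.1 h hs.2) (hρle _ _ hr.1 h hs.2) hκ.le) hR)
    · have := hu s r hs.1 h hr.2
      rw [hur, zero_sub, norm_neg] at this
      refine this.trans (mul_le_mul_of_nonneg_left (Real.rpow_le_rpow
        (hρ.nonneg _ _ hs.1 h hr.2) (hρle _ _ hs.1 h hr.2) hκ.le) hR)
  have step : ∀ R, 0 ≤ R →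
      (∀ s t, a ≤ s → s ≤ t → t ≤ b → ‖u t - u s‖ ≤ R * ρ s t ^ κ) →
      ∀ s t, a ≤ s → s ≤ t → t ≤ b → ‖u t - u s‖ ≤ (R / 2) * ρ s t ^ κ := by
    intro R hR hu s t has hst htb
    have hM := hsup R hR hu
    have hεκ1 : ε ^ κ ≤ 1 := Real.rpow_le_one hε0 hε1 hκ.le
    have hεκ0 : 0 ≤ ε ^ κ := Real.rpow_nonneg hε0 _
    have hGinc : ∀ s t, a ≤ s → s ≤ t → t ≤ b → ‖G t - G s‖ ≤ ((Lg + C) * R) * ρ s t ^ θ := by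
      intro s t has hst htb
      have h0 := hρ.nonneg s t has hst htb
      have e1 : ρ s t ^ κ ≤ ρ s t ^ θ := by
        have := rpow_le_rpow_sub_mul_rpow h0 ((hρle s t has hst htb).trans hε1) hθ hθκ
        simpa using this
      have e2 : ‖u s‖ ≤ R := (hM s ⟨has, hst.trans htb⟩).trans
        (mul_le_of_le_one_right hR hεκ1)
      have h3 : 0 ≤ ρ s t ^ θ := Real.rpow_nonneg h0 _
      calc ‖G t - G s‖ ≤ Lg * ‖u t - u s‖ + C * ρ s t ^ θ * ‖u s‖ := hG s t has hst htb
        _ ≤ Lg * (R * ρ s t ^ θ) + C * ρ s t ^ θ * R := by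
          gcongr
          exact (hu s t has hst htb).trans (mul_le_mul_of_nonneg_left e1 hR)
        _ = _ := by ring
    have hsew := (hρ.almostAdditive (by positivity) hθ.le (hκ.le.trans hκπ) hGinc
      hω).norm_sub_sub_le hρ hθπ hJ has hst htb
    have h0 := hρ.nonneg s t has hst htb
    have hρ1 := (hρle s t has hst htb).trans hε1
    have hκnn : 0 ≤ ρ s t ^ κ := Real.rpow_nonneg h0 _
    have e1 : t - s ≤ ρ s t ^ κ := by
      have := rpow_le_rpow_sub_mul_rpow h0 hρ1 hκ hκ1
      simp only [Real.rpow_one, Real.one_rpow, one_mul] at this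
      exact (hlen s t has hst htb).trans this
    have e2 : ‖ω t - ω s‖ ≤ ρ s t ^ κ := by
      have := rpow_le_rpow_sub_mul_rpow h0 hρ1 hκ hκπ
      simp only [Real.one_rpow, one_mul] at this
      exact (hω s t has hst htb).trans this
    have e3 : ρ s t ^ (θ + π) ≤ ε ^ (θ + π - κ) * ρ s t ^ κ :=
      rpow_le_rpow_sub_mul_rpow h0 (hρle s t has hst htb) hκ (by linarith)
    have b1 : ‖(u t - u s) - (J t - J s)‖ ≤ L * (R * ε ^ κ) * ρ s t ^ κ :=
      (hdrift _ hM s t has hst htb).trans (mul_le_mul_of_nonneg_left e1 (by positivity))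
    have b2 : ‖G s (ω t - ω s)‖ ≤ Lg * (R * ε ^ κ) * ρ s t ^ κ := by
      refine ((G s).le_opNorm _).trans (mul_le_mul ?_ e2 (norm_nonneg _) (by positivity))
      exact (hG0 s ⟨has, hst.trans htb⟩).trans
        (mul_le_mul_of_nonneg_left (hM s ⟨has, hst.trans htb⟩) hLg)
    have b3 : ‖J t - J s - G s (ω t - ω s)‖ ≤
        sewingConst (θ + π) * ((Lg + C) * R) * (ε ^ (θ + π - κ) * ρ s t ^ κ) := by
      have := sewingConst_nonneg hθπ
      exact hsew.trans (mul_le_mul_of_nonneg_left e3 (by positivity))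
    calc ‖u t - u s‖ = ‖((u t - u s) - (J t - J s)) + G s (ω t - ω s)
          + (J t - J s - G s (ω t - ω s))‖ := by congr 1; abel
      _ ≤ L * (R * ε ^ κ) * ρ s t ^ κ + Lg * (R * ε ^ κ) * ρ s t ^ κ +
          sewingConst (θ + π) * ((Lg + C) * R) * (ε ^ (θ + π - κ) * ρ s t ^ κ) :=
        (norm_add_le _ _).trans (add_le_add ((norm_add_le _ _).trans (add_le_add b1 b2)) b3)
      _ = ((L + Lg) * ε ^ κ + sewingConst (θ + π) * (Lg + C) * ε ^ (θ + π - κ))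
          * (R * ρ s t ^ κ) := by ring
      _ ≤ 1 / 2 * (R * ρ s t ^ κ) := mul_le_mul_of_nonneg_right hcontr (by positivity)
      _ = _ := by ring
  have iter : ∀ n : ℕ, ∀ s t, a ≤ s → s ≤ t → t ≤ b →
      ‖u t - u s‖ ≤ (R * (1 / 2) ^ n) * ρ s t ^ κ := by
    intro n
    induction n with
    | zero => simpa using hu
    | succ n ih =>
      intro s t h1 h2 h3
      refine (step _ (by positivity) ih s t h1 h2 h3).trans (le_of_eq ?_)
      ring
  intro s hs
  rw [← norm_le_zero_iff]
  have hlim : Filter.Tendsto (fun n : ℕ => R * (1 / 2 : ℝ) ^ n * ε ^ κ) Filter.atTop (nhds 0) := by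
    simpa using ((tendsto_pow_atTop_nhds_zero_of_lt_one (r := (1 / 2 : ℝ)) (by norm_num)
      (by norm_num)).const_mul R).mul_const (ε ^ κ)
  exact ge_of_tendsto' hlim fun n => hsup _ (by positivity) (iter n) s hs

/-- A zero set which is stable under steps of bounded length is everything. -/
theorem forall_eq_zero_of_step {F : Type*} [Zero F] {a b η : ℝ} (hη : 0 < η) {u : ℝ → F}
    (hstep : ∀ r ∈ Icc a b, ∀ s ∈ Icc a b, |s - r| < η → u r = 0 → u s = 0)
    {r : ℝ} (hr : r ∈ Icc a b) (hur : u r = 0) : ∀ s ∈ Icc a b, u s = 0 := by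
  intro s hs
  obtain ⟨n, hn⟩ := exists_nat_gt (|s - r| / η)
  have hn0 : (0 : ℝ) < n := (div_nonneg (abs_nonneg _) hη.le).trans_lt hn
  have hmem : ∀ k : ℕ, k ≤ n → r + (k / n : ℝ) * (s - r) ∈ Icc a b := by
    intro k hk
    have h1 : (k / n : ℝ) ≤ 1 := by
      rw [div_le_one hn0]
      exact_mod_cast hk
    have h2 : (0 : ℝ) ≤ k / n := by positivity
    have := (convex_Icc a b).add_smul_sub_mem hr hs ⟨h2, h1⟩
    simpa using this
  have key : ∀ k : ℕ, k ≤ n → u (r + (k / n : ℝ) * (s - r)) = 0 := by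
    intro k
    induction k with
    | zero => simpa using hur
    | succ k ih =>
      intro hk
      refine hstep _ (hmem k (by omega)) _ (hmem (k + 1) hk) ?_ (ih (by omega))
      have e : r + ((k + 1 : ℕ) / n : ℝ) * (s - r) - (r + (k / n : ℝ) * (s - r))
          = (s - r) / n := by
        push_cast
        ring
      rw [e, abs_div, abs_of_pos hn0, div_lt_iff₀ hn0]
      rwa [div_lt_iff₀ hη, mul_comm] at hn
  have := key n le_rfl
  rwa [div_self hn0.ne', one_mul, add_sub_cancel] at this

end Uniqueness
/-- Theorem `flow1`, different trajectories do not intersect: under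
(H1)–(H3), if `x` and `x̂` are two solutions of finite `q`-variation on `[0,T]` of the Young
differential equation (with possibly different initial values) and `x a = x̂ a` for some
`a ∈ [0,T]`, then `x t = x̂ t` for all `t ∈ [0,T]`. -/
theorem stmt17
    {d m : ℕ} (p T : ℝ) (hp1 : 1 < p) (hp2 : p < 2) (hT : 0 < T)
    (f : ℝ → Ed d → Ed d) (g : ℝ → Ed d → (Ed m →L[ℝ] Ed d))
    (hf : ContinuousOn (fun pr : ℝ × Ed d => f pr.1 pr.2) (Set.Icc 0 T ×ˢ Set.univ))
    (hg : ContinuousOn (fun pr : ℝ × Ed d => g pr.1 pr.2) (Set.Icc 0 T ×ˢ Set.univ))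
    (Dg : ℝ → Ed d → (Ed d →L[ℝ] Ed m →L[ℝ] Ed d))
    (hDg : ∀ t ∈ Set.Icc (0:ℝ) T, ∀ x : Ed d, HasFDerivAt (g t) (Dg t x) x)
    (β δ Lg : ℝ) (hβ0 : 0 < β) (hβ1 : β ≤ 1) (hδ0 : 0 < δ) (hδ1 : δ ≤ 1) (hLg : 0 < Lg)
    (h : ℝ → ℝ → ℝ) (hctrl : IsControlOn 0 T h)
    (MN : ℝ → ℝ) (hMN : ∀ N : ℝ, 0 ≤ N → 0 < MN N)
    (H1i : ∀ t ∈ Set.Icc (0:ℝ) T, ∀ x y : Ed d, ‖g t x - g t y‖ ≤ Lg * ‖x - y‖)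
    (H1ii : ∀ N : ℝ, 0 ≤ N → ∀ t ∈ Set.Icc (0:ℝ) T, ∀ x y : Ed d, ‖x‖ ≤ N → ‖y‖ ≤ N →
      ‖Dg t x - Dg t y‖ ≤ MN N * ‖x - y‖ ^ δ)
    (H1iii : ∀ s t : ℝ, 0 ≤ s → s < t → t ≤ T → ∀ x : Ed d,
      ‖g t x - g s x‖ + ‖Dg t x - Dg s x‖ ≤ h s t ^ β)
    (a α : ℝ) (b : ℝ → ℝ) (ha : 0 < a) (hα1 : 1 / 2 ≤ α) (hα2 : α < 1)
    (hbmem : IntervalIntegrable (fun s => |b s| ^ (1 / (1 - α))) MeasureTheory.volume 0 T)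
    (LN : ℝ → ℝ) (hLN : ∀ N : ℝ, 0 ≤ N → 0 < LN N)
    (H2i : ∀ N : ℝ, 0 ≤ N → ∀ t ∈ Set.Icc (0:ℝ) T, ∀ x y : Ed d, ‖x‖ ≤ N → ‖y‖ ≤ N →
      ‖f t x - f t y‖ ≤ LN N * ‖x - y‖)
    (H2ii : ∀ t ∈ Set.Icc (0:ℝ) T, ∀ x : Ed d, ‖f t x‖ ≤ a * ‖x‖ + b t)
    (H3a : p - 1 < δ) (H3b : 1 - 1 / p < β) (H3c : 1 - 1 / p < δ * α)
    (q0 q : ℝ)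
    (hq0a : 1 - 1 / p < 1 / q0)
    (hq0b : 1 / q0 < min (min β (δ * α)) (min (δ / p) (1 / 2)))
    (hqa : 1 / (q0 * δ) ≤ 1 / q) (hqb : 1 / q < min α (1 / p))
    (ω : ℝ → Ed m) (hω : ContinuousOn ω (Set.Icc 0 T)) (hωp : FinitePVar p ω 0 T)
    (x xhat : ℝ → Ed d)
    (hx : IsSolutionOn f g ω q 0 T (x 0) x)
    (hxhat : IsSolutionOn f g ω q 0 T (xhat 0) xhat)
    (A : ℝ) (hA : A ∈ Set.Icc (0:ℝ) T) (hagree : x A = xhat A) :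
    ∀ t ∈ Set.Icc (0:ℝ) T, x t = xhat t := by
  obtain ⟨hxc, hxq, -, hxe⟩ := hx
  obtain ⟨hyc, hyq, -, hye⟩ := hxhat
  -- exponents
  have hP0 : 0 < 1 / p := by positivity
  have hP1 : 1 / p < 1 := by rw [div_lt_one] <;> linarith
  have hq0 : 0 < 1 / q0 := by linarith
  have hQδ : 1 / q0 ≤ δ * (1 / q) := by
    have : 1 / (q0 * δ) = 1 / q0 / δ := by rw [div_div]
    rwa [this, div_le_iff₀ hδ0, mul_comm] at hqa
  have hQ0 : 0 < 1 / q := pos_of_mul_pos_right (hq0.trans_le hQδ) hδ0.le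
  have hqpos : 0 < q := one_div_pos.1 hQ0
  have hQP : 1 / q < 1 / p := hqb.trans_le (min_le_right _ _)
  obtain ⟨μ, hμ, hμ1⟩ : ∃ μ, max ((1 - β) / (1 / p)) (1 / (δ * (1 / q) + 1 / p)) < μ ∧ μ < 1 := by
    refine exists_between (max_lt ?_ ?_)
    · rw [div_lt_one hP0]
      linarith
    · rw [div_lt_one (by positivity)]
      linarith
  obtain ⟨hμβ, hμδ⟩ := max_lt_iff.1 hμ
  have hμ0 : 0 < μ := lt_trans (by positivity) hμδ
  rw [div_lt_iff₀ hP0] at hμβ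
  rw [div_lt_iff₀ (by positivity)] at hμδ
  have hpμ : p < p / μ := by rw [lt_div_iff₀ hμ0]; nlinarith
  have hqμ : q < q / μ := by rw [lt_div_iff₀ hμ0]; nlinarith
  obtain ⟨ρx, hρx, hρxle⟩ := hxq.exists_control hT.le hxc hqpos hqμ
  obtain ⟨ρy, hρy, hρyle⟩ := hyq.exists_control hT.le hyc hqpos hqμ
  obtain ⟨ρω, hρω, hρωle⟩ := hωp.exists_control hT.le hω (by linarith) hpμ
  have hκdef : 1 / (q / μ) = μ * (1 / q) := by rw [one_div_div]; ring
  have hπdef : 1 / (p / μ) = μ * (1 / p) := by rw [one_div_div]; ring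
  rw [hκdef] at hρxle hρyle
  rw [hπdef] at hρωle
  have hκ : 0 < μ * (1 / q) := by positivity
  have hκπ : μ * (1 / q) ≤ μ * (1 / p) := by gcongr
  have hπ1 : μ * (1 / p) ≤ 1 := by nlinarith
  have hexp : ∃ θ, 0 < θ ∧ θ ≤ β ∧ θ ≤ μ * (1 / q) * δ ∧ 1 < θ + μ * (1 / p) := by
    refine ⟨min β (μ * (1 / q) * δ), lt_min hβ0 (by positivity), min_le_left _ _,
      min_le_right _ _, ?_⟩
    rw [← min_add_add_right]
    exact lt_min (by linarith) (by linarith)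
  obtain ⟨θ, hθ0, hθβ, hθδ, hθπ⟩ := hexp
  generalize μ * (1 / q) = κ at *
  generalize μ * (1 / p) = π at *
  have hθκ : θ ≤ κ := hθδ.trans (mul_le_of_le_one_right hκ.le hδ1)
  have hπ0 : 0 ≤ π := hκ.le.trans hκπ
  -- the common control
  have hh := IsUniformControl.of_isControlOn hctrl
  have hlen := IsUniformControl.length 0 T
  obtain ⟨ρ, hρ, hle, hleh, hlex, hley, hleω⟩ : ∃ ρ, IsUniformControl 0 T ρ ∧
      (∀ s t, 0 ≤ s → s ≤ t → t ≤ T → t - s ≤ ρ s t) ∧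
      (∀ s t, 0 ≤ s → s ≤ t → t ≤ T → h s t ≤ ρ s t) ∧
      (∀ s t, 0 ≤ s → s ≤ t → t ≤ T → ‖x t - x s‖ ≤ ρ s t ^ κ) ∧
      (∀ s t, 0 ≤ s → s ≤ t → t ≤ T → ‖xhat t - xhat s‖ ≤ ρ s t ^ κ) ∧
      (∀ s t, 0 ≤ s → s ≤ t → t ≤ T → ‖ω t - ω s‖ ≤ ρ s t ^ π) := by
    refine ⟨_, (((hlen.add hh).add hρx).add hρy).add hρω, ?_⟩
    have hnn : ∀ s t, 0 ≤ s → s ≤ t → t ≤ T →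
        0 ≤ t - s ∧ 0 ≤ h s t ∧ 0 ≤ ρx s t ∧ 0 ≤ ρy s t ∧ 0 ≤ ρω s t := fun s t h1 h2 h3 =>
      ⟨hlen.nonneg s t h1 h2 h3, hh.nonneg s t h1 h2 h3, hρx.nonneg s t h1 h2 h3,
        hρy.nonneg s t h1 h2 h3, hρω.nonneg s t h1 h2 h3⟩
    refine ⟨fun s t h1 h2 h3 => ?_, fun s t h1 h2 h3 => ?_,
      fun s t h1 h2 h3 => (hρxle s t h1 h2 h3).trans (Real.rpow_le_rpow ?_ ?_ hκ.le),
      fun s t h1 h2 h3 => (hρyle s t h1 h2 h3).trans (Real.rpow_le_rpow ?_ ?_ hκ.le),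
      fun s t h1 h2 h3 => (hρωle s t h1 h2 h3).trans (Real.rpow_le_rpow ?_ ?_ hπ0)⟩ <;>
    linarith [(hnn s t h1 h2 h3).1, (hnn s t h1 h2 h3).2.1, (hnn s t h1 h2 h3).2.2.1,
      (hnn s t h1 h2 h3).2.2.2.1, (hnn s t h1 h2 h3).2.2.2.2]
  set B := ρ 0 T
  have hB0 : 0 ≤ B := hρ.nonneg 0 T le_rfl hT.le le_rfl
  have hlow : ∀ e, θ ≤ e → ∀ s t, 0 ≤ s → s ≤ t → t ≤ T →
      ρ s t ^ e ≤ B ^ (e - θ) * ρ s t ^ θ := fun e he s t h1 h2 h3 =>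
    rpow_le_rpow_sub_mul_rpow (hρ.nonneg s t h1 h2 h3) (hρ.mono le_rfl h1 h2 h3 le_rfl) hθ0 he
  have hgt : ∀ s t, 0 ≤ s → s ≤ t → t ≤ T → ∀ z : Ed d,
      ‖g t z - g s z‖ + ‖Dg t z - Dg s z‖ ≤ B ^ (β - θ) * ρ s t ^ θ := by
    intro s t h1 h2 h3 z
    refine le_trans ?_ (hlow β hθβ s t h1 h2 h3)
    rcases h2.eq_or_lt with rfl | hlt
    · have e : ‖Dg s z - Dg s z‖ = 0 := by
        rw [show Dg s z - Dg s z = 0 from sub_self (Dg s z)]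
        exact ContinuousLinearMap.opNorm_zero
      rw [sub_self, norm_zero, e, add_zero]
      exact Real.rpow_nonneg (hρ.nonneg s s h1 le_rfl h3) β
    · exact (H1iii s t h1 hlt h3 z).trans (Real.rpow_le_rpow (hh.nonneg s t h1 h2 h3)
        (hleh s t h1 h2 h3) hβ0.le)
  -- the Young integrals
  have hYoung : ∀ z : ℝ → Ed d,
      (∀ s t, 0 ≤ s → s ≤ t → t ≤ T → ‖z t - z s‖ ≤ ρ s t ^ κ) → ∀ s t, 0 ≤ s → s ≤ t → t ≤ T →
      ‖youngIntegral (fun s => g s (z s)) ω 0 t - youngIntegral (fun s => g s (z s)) ω 0 s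
        - g s (z s) (ω t - ω s)‖
      ≤ sewingConst (θ + π) * (Lg * B ^ (κ - θ) + B ^ (β - θ)) * ρ s t ^ (θ + π) := by
    intro z hz
    refine hρ.exists_youngIntegral (Y := fun s => g s (z s)) (by positivity) hθ0.le hπ0 hθπ ?_ hleω
    intro s t h1 h2 h3
    have e1 := H1i t ⟨h1.trans h2, h3⟩ (z t) (z s)
    have e2 := hgt s t h1 h2 h3 (z s)
    have e3 := mul_le_mul_of_nonneg_left ((hz s t h1 h2 h3).trans (hlow κ hθκ s t h1 h2 h3)) hLg.le
    have e4 := norm_add_le (g t (z t) - g t (z s)) (g t (z s) - g s (z s))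
    rw [sub_add_sub_cancel] at e4
    have e5 := norm_nonneg (Dg t (z s) - Dg s (z s))
    linarith
  have hIx := hYoung x hlex
  have hIy := hYoung xhat hley
  -- bounds for the two paths
  obtain ⟨N₁, hN₁⟩ := isCompact_Icc.exists_bound_of_continuousOn hxc
  obtain ⟨N₂, hN₂⟩ := isCompact_Icc.exists_bound_of_continuousOn hyc
  obtain ⟨N, hN0, hNx, hNy⟩ : ∃ N, 0 ≤ N ∧ (∀ t ∈ Icc 0 T, ‖x t‖ ≤ N) ∧
      ∀ t ∈ Icc 0 T, ‖xhat t‖ ≤ N :=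
    ⟨max N₁ N₂, (norm_nonneg _).trans ((hN₁ A hA).trans (le_max_left _ _)),
      fun t ht => (hN₁ t ht).trans (le_max_left _ _),
      fun t ht => (hN₂ t ht).trans (le_max_right _ _)⟩
  have hLN0 := hLN N hN0
  have hMN0 := hMN N hN0
  have hfint : ∀ z : ℝ → Ed d, ContinuousOn z (Icc 0 T) → ∀ s ∈ Icc 0 T, ∀ t ∈ Icc 0 T,
      IntervalIntegrable (fun r => f r (z r)) MeasureTheory.volume s t := by
    intro z hz s hs t ht
    have hc : ContinuousOn (fun r => f r (z r)) (Icc 0 T) :=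
      hf.comp (continuousOn_id.prodMk hz) fun r hr => ⟨hr, mem_univ _⟩
    exact (hc.mono (uIcc_subset_Icc hs ht)).intervalIntegrable
  have h0mem : (0 : ℝ) ∈ Icc 0 T := ⟨le_rfl, hT.le⟩
  have hdrift : ∀ c e M, 0 ≤ c → e ≤ T → (∀ r ∈ Icc c e, ‖x r - xhat r‖ ≤ M) →
      ∀ s t, c ≤ s → s ≤ t → t ≤ e →
      ‖((x t - xhat t) - (x s - xhat s))
        - ((youngIntegral (fun s => g s (x s)) ω 0 t - youngIntegral (fun s => g s (xhat s)) ω 0 t)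
        - (youngIntegral (fun s => g s (x s)) ω 0 s
          - youngIntegral (fun s => g s (xhat s)) ω 0 s))‖ ≤ LN N * M * (t - s) := by
    intro c e M hc he hM s t h1 h2 h3
    have hs : s ∈ Icc 0 T := ⟨hc.trans h1, h2.trans (h3.trans he)⟩
    have ht : t ∈ Icc 0 T := ⟨hs.1.trans h2, h3.trans he⟩
    have ex := intervalIntegral.integral_interval_sub_left (hfint x hxc 0 h0mem t ht)
      (hfint x hxc 0 h0mem s hs)
    have ey := intervalIntegral.integral_interval_sub_left (hfint xhat hyc 0 h0mem t ht)
      (hfint xhat hyc 0 h0mem s hs)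
    have e1 : ((x t - xhat t) - (x s - xhat s))
        - ((youngIntegral (fun s => g s (x s)) ω 0 t - youngIntegral (fun s => g s (xhat s)) ω 0 t)
        - (youngIntegral (fun s => g s (x s)) ω 0 s
          - youngIntegral (fun s => g s (xhat s)) ω 0 s))
        = ∫ r in s..t, (f r (x r) - f r (xhat r)) := by
      rw [intervalIntegral.integral_sub (hfint x hxc s hs t ht) (hfint xhat hyc s hs t ht),
        ← ex, ← ey, hxe t ht, hxe s hs, hye t ht, hye s hs]
      abel
    rw [e1]
    refine (intervalIntegral.norm_integral_le_of_norm_le_const (C := LN N * M)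
      fun r hr => ?_).trans (le_of_eq ?_)
    · rw [uIoc_of_le h2] at hr
      have hr' : r ∈ Icc 0 T := ⟨hs.1.trans hr.1.le, hr.2.trans ht.2⟩
      exact (H2i N hN0 r hr' _ _ (hNx r hr') (hNy r hr')).trans
        (mul_le_mul_of_nonneg_left (hM r ⟨h1.trans hr.1.le, hr.2.trans h3⟩) hLN0.le)
    · rw [abs_of_nonneg (sub_nonneg.2 h2)]
  -- the increments of the difference of the integrands
  have hDgle : ∀ t ∈ Icc (0 : ℝ) T, ∀ z, ‖Dg t z‖ ≤ Lg := fun t ht z =>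
    (hDg t ht z).le_of_lip' hLg.le (Filter.Eventually.of_forall fun w => H1i t ht w z)
  have hGinc : ∀ s t, 0 ≤ s → s ≤ t → t ≤ T →
      ‖(g t (x t) - g t (xhat t)) - (g s (x s) - g s (xhat s))‖
      ≤ Lg * ‖(x t - xhat t) - (x s - xhat s)‖
        + (B ^ (β - θ) + MN N * B ^ (κ * δ - θ)) * ρ s t ^ θ * ‖x s - xhat s‖ := by
    intro s t h1 h2 h3
    have hs : s ∈ Icc 0 T := ⟨h1, h2.trans h3⟩
    have ht : t ∈ Icc 0 T := ⟨h1.trans h2, h3⟩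
    refine norm_four_point_le (hDg t ht) (hDg s hs) (hDgle t ht) fun τ hτ => ?_
    have hball : ∀ r ∈ Icc 0 T, ‖xhat r + τ • (x r - xhat r)‖ ≤ N := fun r hr => by
      have := (convex_closedBall (0 : Ed d) N).add_smul_sub_mem
        (mem_closedBall_zero_iff.2 (hNy r hr)) (mem_closedBall_zero_iff.2 (hNx r hr)) hτ
      simpa using this
    have hdist : ‖(xhat t + τ • (x t - xhat t)) - (xhat s + τ • (x s - xhat s))‖
        ≤ ρ s t ^ κ := by
      have e : (xhat t + τ • (x t - xhat t)) - (xhat s + τ • (x s - xhat s))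
          = (1 - τ) • (xhat t - xhat s) + τ • (x t - x s) := by module
      have := (convex_closedBall (0 : Ed d) (ρ s t ^ κ))
        (mem_closedBall_zero_iff.2 (hley s t h1 h2 h3))
        (mem_closedBall_zero_iff.2 (hlex s t h1 h2 h3)) (sub_nonneg.2 hτ.2) hτ.1
        (sub_add_cancel 1 τ)
      rw [e]
      simpa using this
    have e1 := hgt s t h1 h2 h3 (xhat t + τ • (x t - xhat t))
    have e2 := norm_nonneg (g t (xhat t + τ • (x t - xhat t)) - g s (xhat t + τ • (x t - xhat t)))
    have e3 := H1ii N hN0 s hs _ _ (hball t ht) (hball s hs)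
    have e4 : ‖(xhat t + τ • (x t - xhat t)) - (xhat s + τ • (x s - xhat s))‖ ^ δ
        ≤ B ^ (κ * δ - θ) * ρ s t ^ θ := by
      refine le_trans ?_ (hlow (κ * δ) hθδ s t h1 h2 h3)
      rw [Real.rpow_mul (hρ.nonneg s t h1 h2 h3)]
      exact Real.rpow_le_rpow (norm_nonneg _) hdist hδ0.le
    have e5 := mul_le_mul_of_nonneg_left e4 hMN0.le
    refine (norm_sub_le_norm_sub_add_norm_sub _ (Dg s (xhat t + τ • (x t - xhat t))) _).trans ?_
    linarith
  -- choice of the step length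
  obtain ⟨ε, ⟨hε1, hεc⟩, hε0⟩ : ∃ ε : ℝ, (ε < 1 ∧ (LN N + Lg) * ε ^ κ + sewingConst (θ + π) *
      (Lg + (B ^ (β - θ) + MN N * B ^ (κ * δ - θ))) * ε ^ (θ + π - κ) < 1 / 2) ∧
      ε ∈ Ioi (0 : ℝ) := by
    have hcont : ContinuousAt (fun ε : ℝ => (LN N + Lg) * ε ^ κ + sewingConst (θ + π) *
        (Lg + (B ^ (β - θ) + MN N * B ^ (κ * δ - θ))) * ε ^ (θ + π - κ)) 0 :=
      (continuousAt_const.mul (Real.continuousAt_rpow_const _ _ (Or.inr hκ.le))).add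
        (continuousAt_const.mul (Real.continuousAt_rpow_const _ _ (Or.inr (by linarith))))
    have hlim := hcont.tendsto.mono_left (nhdsWithin_le_nhds (s := Ioi 0))
    simp only [Real.zero_rpow hκ.ne', Real.zero_rpow (by linarith : θ + π - κ ≠ 0), mul_zero,
      add_zero] at hlim
    have hone : ∀ᶠ ε : ℝ in nhdsWithin 0 (Ioi 0), ε < 1 :=
      nhdsWithin_le_nhds (gt_mem_nhds one_pos)
    exact ((hone.and (hlim.eventually (gt_mem_nhds one_half_pos))).and self_mem_nhdsWithin).exists
  obtain ⟨η, hη, hsmall⟩ := hρ.small ε hε0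
  suffices hzero : ∀ t ∈ Icc 0 T, x t - xhat t = 0 from fun t ht => sub_eq_zero.1 (hzero t ht)
  refine forall_eq_zero_of_step (u := fun t => x t - xhat t) hη (fun r hr s hs hrs hur => ?_) hA
    (sub_eq_zero.2 hagree)
  have hc : 0 ≤ min r s := le_min hr.1 hs.1
  have he : max r s ≤ T := max_le hr.2 hs.2
  have hce : max r s - min r s < η := by rwa [max_sub_min_eq_abs]
  refine (hρ.restrict hc he).eq_zero_of_contraction
    (u := fun t => x t - xhat t) (G := fun s => g s (x s) - g s (xhat s)) (ω := ω)
    (J := fun t => youngIntegral (fun s => g s (x s)) ω 0 t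
      - youngIntegral (fun s => g s (xhat s)) ω 0 t)
    (C' := 2 * (sewingConst (θ + π) * (Lg * B ^ (κ - θ) + B ^ (β - θ)))) (R := 2)
    hκ (hκπ.trans hπ1) hκπ hθ0 hθκ hθπ hLN0.le hLg.le (by positivity) zero_le_two
    (fun s t h1 h2 h3 => hle s t (hc.trans h1) h2 (h3.trans he))
    (fun s t h1 h2 h3 => hleω s t (hc.trans h1) h2 (h3.trans he))
    (fun s t h1 h2 h3 => ?_) (fun s t h1 h2 h3 => ?_)
    (fun M hM => hdrift _ _ M hc he hM)
    (fun s hs => H1i s ⟨hc.trans hs.1, hs.2.trans he⟩ _ _)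
    (fun s t h1 h2 h3 => hGinc s t (hc.trans h1) h2 (h3.trans he))
    hε1.le (hsmall _ _ hc min_le_max he hce) hεc.le
    ⟨min_le_left _ _, le_max_left _ _⟩ hur s ⟨min_le_right _ _, le_max_right _ _⟩
  · have e1 := hlex s t (hc.trans h1) h2 (h3.trans he)
    have e2 := hley s t (hc.trans h1) h2 (h3.trans he)
    have e3 := norm_sub_le (x t - x s) (xhat t - xhat s)
    rw [sub_sub_sub_comm]
    linarith
  · have e1 := hIx s t (hc.trans h1) h2 (h3.trans he)
    have e2 := hIy s t (hc.trans h1) h2 (h3.trans he)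
    simp only [sub_apply]
    refine le_trans (le_of_eq ?_) ((norm_sub_le _ _).trans ((add_le_add e1 e2).trans
      (le_of_eq (by ring))))
    congr 1
    abel
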